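/- arXiv:2002.06953 — 7 statements merged into one kernel-verified Lean document; each statement's English description precedes it below -/
import Mathlib

section
/- Fix an integer k ≥ 3 and a function ω(n) → ∞. Suppose p = p(n) ∈ (0,1) satisfies p ≥ ω(n)·n^{-(k-2)}·log n and 1 - p ≥ ω(n)·n^{-(k-2)}·log n. Then for every constant K > 0, for all sufficiently large n, the probability that the binomial random k-uniform hypergraph H(n,p;k) contains two distinct vertices i ≠ j whose links H_i and H_j are isomorphic is at most n^{-K}. -/
open MeasureTheory Filter

/-- The Bernoulli(p) measure on `Bool` (assigning mass `p` to `true` and `1-p` to `false`). -/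
noncomputable def bernoulliMeasure (p : ℝ) : Measure Bool :=
  ENNReal.ofReal p • Measure.dirac true + ENNReal.ofReal (1 - p) • Measure.dirac false

/-- The distribution of the binomial random `k`-uniform hypergraph `H(n,p;k)`:
the product of independent Bernoulli(p) coordinates indexed by the `k`-element
subsets of `[n]`. -/
noncomputable def hypergraphMeasure (n k : ℕ) (p : ℝ) :
    Measure ({s : Finset (Fin n) // s.card = k} → Bool) :=
  Measure.pi fun _ => bernoulliMeasure p

/-- The edge predicate of the hypergraph encoded by a sample point `ω`. -/
def isEdge {n k : ℕ} (ω : {s : Finset (Fin n) // s.card = k} → Bool)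
    (e : Finset (Fin n)) : Prop :=
  ∃ h : e.card = k, ω ⟨e, h⟩ = true

/-- The links `H_i` and `H_j` of the `k`-uniform hypergraph with edge predicate `E`
are isomorphic: there is a bijection from `[n] \ {i}` to `[n] \ {j}` (encoded as a
permutation of `[n]` sending `i` to `j`) mapping edges of the link of `i` to edges
of the link of `j` and non-edges to non-edges. -/
def LinksIso (n k : ℕ) (E : Finset (Fin n) → Prop) (i j : Fin n) : Prop :=
  ∃ f : Equiv.Perm (Fin n), f i = j ∧
    ∀ e : Finset (Fin n), e.card = k - 1 → i ∉ e →
      (E (insert i e) ↔ E (insert j (e.image f)))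

/-- `bernoulliMeasure p` is a probability measure for `p ∈ [0, 1]`. -/
theorem bernoulliMeasure_isProbabilityMeasure (p : ℝ) (hp0 : 0 ≤ p) (hp1 : p ≤ 1) :
    IsProbabilityMeasure (bernoulliMeasure p) := by
  constructor
  simp only [bernoulliMeasure, Measure.add_apply, Measure.smul_apply, measure_univ, smul_eq_mul,
    mul_one]
  rw [← ENNReal.ofReal_add hp0 (by linarith)]
  simp

/-- The two-valued coordinates agree along pairwise disjoint pairs of indices with the expected
probability. -/
theorem bernoulli_pi_agree {ι α : Type*} [Fintype ι] (p : ℝ) (hp0 : 0 ≤ p) (hp1 : p ≤ 1)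
    (g h : α → ι) (A : Finset α) (hg : Set.InjOn g A) (hh : Set.InjOn h A)
    (hgh : ∀ a ∈ A, ∀ b ∈ A, g a ≠ h b) :
    (Measure.pi fun _ : ι => bernoulliMeasure p) {x | ∀ a ∈ A, x (g a) = x (h a)}
      = ENNReal.ofReal (1 - 2 * (p * (1 - p))) ^ A.card := by
  classical
  have hprob := bernoulliMeasure_isProbabilityMeasure p hp0 hp1
  have hind : ProbabilityTheory.iIndepFun (fun (i : ι) (x : ι → Bool) => x i)
      (Measure.pi fun _ : ι => bernoulliMeasure p) :=
    ProbabilityTheory.iIndepFun_pi (X := fun _ => id) (fun _ => aemeasurable_id)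
  induction A using Finset.induction_on with
  | empty => simp
  | insert a A ha ih =>
    have hpair : (Measure.pi fun _ : ι => bernoulliMeasure p) {x | x (g a) = x (h a)}
        = ENNReal.ofReal (1 - 2 * (p * (1 - p))) := by
      have hne : g a ≠ h a := hgh a (by simp) a (by simp)
      have hsplit : {x : ι → Bool | x (g a) = x (h a)} =
          ((fun x => x (g a)) ⁻¹' {true} ∩ (fun x => x (h a)) ⁻¹' {true}) ∪
          ((fun x => x (g a)) ⁻¹' {false} ∩ (fun x => x (h a)) ⁻¹' {false}) := by
        ext x
        cases h1 : x (g a) <;> cases h2 : x (h a) <;> simp [h1, h2]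
      have hcoord (i : ι) (b : Bool) : (Measure.pi fun _ : ι => bernoulliMeasure p)
          ((fun x => x i) ⁻¹' {b}) = bernoulliMeasure p {b} :=
        (measurePreserving_eval (fun _ : ι => bernoulliMeasure p) i).measure_preimage
          (measurableSet_singleton b).nullMeasurableSet
      rw [hsplit, measure_union _ (Set.toFinite _).measurableSet,
        (hind.indepFun hne).measure_inter_preimage_eq_mul _ _ (measurableSet_singleton _)
          (measurableSet_singleton _),
        (hind.indepFun hne).measure_inter_preimage_eq_mul _ _ (measurableSet_singleton _)
          (measurableSet_singleton _)]
      · simp only [hcoord]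
        have ht : bernoulliMeasure p {true} = ENNReal.ofReal p := by simp [bernoulliMeasure]
        have hf : bernoulliMeasure p {false} = ENNReal.ofReal (1 - p) := by
          simp [bernoulliMeasure]
        rw [ht, hf, ← ENNReal.ofReal_mul hp0, ← ENNReal.ofReal_mul (by linarith),
          ← ENNReal.ofReal_add (by positivity) (mul_self_nonneg _)]
        congr 1
        ring
      · rw [Set.disjoint_left]
        rintro x ⟨h1, -⟩ ⟨h2, -⟩
        simp_all
    have hdisj : Disjoint ({g a, h a} : Finset ι) (A.image g ∪ A.image h) := by
      rw [Finset.disjoint_left]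
      intro i hi hi'
      simp only [Finset.mem_insert, Finset.mem_singleton] at hi
      simp only [Finset.mem_union, Finset.mem_image] at hi'
      have hmem : ∀ b ∈ A, b ∈ insert a A := fun b hb => Finset.mem_insert_of_mem hb
      have hself : a ∈ insert a A := Finset.mem_insert_self a A
      rcases hi with rfl | rfl <;> rcases hi' with ⟨b, hb, hba⟩ | ⟨b, hb, hba⟩
      · exact ha (hg (hmem b hb) hself hba ▸ hb)
      · exact hgh a hself b (hmem b hb) hba.symm
      · exact hgh b (hmem b hb) a hself hba
      · exact ha (hh (hmem b hb) hself hba ▸ hb)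
    have hinter := (hind.indepFun_finset _ _ hdisj
      (fun i => measurable_pi_apply i)).measure_inter_preimage_eq_mul
      {y | y ⟨g a, by simp⟩ = y ⟨h a, by simp⟩}
      {y | ∀ b, ∀ hb : b ∈ A,
        y ⟨g b, Finset.mem_union_left _ (Finset.mem_image_of_mem g hb)⟩
          = y ⟨h b, Finset.mem_union_right _ (Finset.mem_image_of_mem h hb)⟩}
      (Set.toFinite _).measurableSet (Set.toFinite _).measurableSet
    have ih' := ih (hg.mono (by simp)) (hh.mono (by simp))
      (fun b hb c hc => hgh b (by simp [hb]) c (by simp [hc]))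
    rw [Finset.card_insert_of_notMem ha, pow_succ', ← ih', ← hpair]
    simp only [Set.preimage_ofPred_eq] at hinter
    rw [← hinter]
    congr 1
    ext x
    simp

/-- For a fixed permutation `f` with `f i = j`, the probability that `f` induces an isomorphism
between the links of `i` and `j`. -/
theorem hypergraphMeasure_perm_le {n k : ℕ} (hk : 1 ≤ k) (p : ℝ) (hp0 : 0 ≤ p) (hp1 : p ≤ 1)
    {i j : Fin n} (hij : i ≠ j) (f : Equiv.Perm (Fin n)) (hf : f i = j) :
    hypergraphMeasure n k p {x | ∀ e : Finset (Fin n), e.card = k - 1 → i ∉ e →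
      (isEdge x (insert i e) ↔ isEdge x (insert j (e.image f)))}
      ≤ ENNReal.ofReal (1 - 2 * (p * (1 - p))) ^ (n - 3).choose (k - 1) := by
  set P := Finset.powersetCard (k - 1) (Finset.univ \ {i, j, f.symm i}) with hP
  have hmem : ∀ e ∈ P, e.card = k - 1 ∧ i ∉ e ∧ j ∉ e ∧ i ∉ e.image f ∧ j ∉ e.image f := by
    intro e he
    rw [hP, Finset.mem_powersetCard] at he
    have hnot : ∀ v ∈ ({i, j, f.symm i} : Finset (Fin n)), v ∉ e := fun v hv hve =>
      (Finset.mem_sdiff.1 (he.1 hve)).2 hv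
    refine ⟨he.2, hnot _ (by simp), hnot _ (by simp), ?_, ?_⟩
    · rw [Finset.mem_image]
      rintro ⟨v, hv, hvi⟩
      exact hnot v (by simp [← hvi]) hv
    · rw [Finset.mem_image]
      rintro ⟨v, hv, hvj⟩
      exact hnot v (by simp [f.injective (hvj.trans hf.symm)]) hv
  have hcard₁ : ∀ e : P, (insert i e.1).card = k := fun e => by
    rw [Finset.card_insert_of_notMem (hmem e e.2).2.1, (hmem e e.2).1]; omega
  have hcard₂ : ∀ e : P, (insert j (e.1.image f)).card = k := fun e => by
    rw [Finset.card_insert_of_notMem (hmem e e.2).2.2.2.2,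
      Finset.card_image_of_injective _ f.injective, (hmem e e.2).1]; omega
  have hagree := bernoulli_pi_agree p hp0 hp1
    (fun e : P => (⟨_, hcard₁ e⟩ : {s : Finset (Fin n) // s.card = k}))
    (fun e : P => ⟨_, hcard₂ e⟩) Finset.univ
    (by
      intro a _ b _ hab
      have hab' := congrArg (fun s => Finset.erase s i) (congrArg Subtype.val hab)
      simp only [Finset.erase_insert (hmem _ a.2).2.1, Finset.erase_insert (hmem _ b.2).2.1]
        at hab'
      exact Subtype.ext hab')
    (by
      intro a _ b _ hab
      have hab' := congrArg (fun s => Finset.erase s j) (congrArg Subtype.val hab)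
      simp only [Finset.erase_insert (hmem _ a.2).2.2.2.2,
        Finset.erase_insert (hmem _ b.2).2.2.2.2] at hab'
      exact Subtype.ext (Finset.image_injective f.injective hab'))
    (by
      intro a _ b _ hab
      have hi : i ∈ insert j (b.1.image f) := by
        have hval : insert i a.1 = insert j (b.1.image f) := congrArg Subtype.val hab
        exact hval ▸ Finset.mem_insert_self i _
      rcases Finset.mem_insert.1 hi with h | h
      · exact hij h
      · exact (hmem b b.2).2.2.2.1 h)
  have hle : (1 : ℝ) - 2 * (p * (1 - p)) ≤ 1 := by nlinarith
  calc _ ≤ _ := measure_mono (by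
        intro x hx e _
        have hxe := hx e.1 (hmem e e.2).1 (hmem e e.2).2.1
        simp only [isEdge, hcard₁ e, hcard₂ e, exists_true_left] at hxe
        exact Bool.eq_iff_iff.2 hxe)
    _ = _ := hagree
    _ ≤ _ := pow_le_pow_right_of_le_one' (ENNReal.ofReal_le_one.2 hle) (by
        rw [Finset.card_univ, Fintype.card_coe, hP, Finset.card_powersetCard]
        refine Nat.choose_le_choose _ ?_
        rw [Finset.card_sdiff_of_subset (Finset.subset_univ _), Finset.card_univ, Fintype.card_fin]
        exact Nat.sub_le_sub_left Finset.card_le_three n)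

/-- Union bound over the pairs of vertices and the permutations. -/
theorem hypergraphMeasure_exists_linksIso_le {n k : ℕ} (hk : 1 ≤ k) (p : ℝ) (hp0 : 0 ≤ p)
    (hp1 : p ≤ 1) :
    hypergraphMeasure n k p {x | ∃ i j : Fin n, i ≠ j ∧ LinksIso n k (isEdge x) i j}
      ≤ (n * (n * n.factorial) : ℕ) *
        ENNReal.ofReal (1 - 2 * (p * (1 - p))) ^ (n - 3).choose (k - 1) := by
  classical
  set B := ENNReal.ofReal (1 - 2 * (p * (1 - p))) ^ (n - 3).choose (k - 1)
  set T : Finset (Fin n × Fin n × Equiv.Perm (Fin n)) :=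
    Finset.univ.filter fun t => t.1 ≠ t.2.1 ∧ t.2.2 t.1 = t.2.1 with hT
  calc _ ≤ hypergraphMeasure n k p (⋃ t ∈ T, {x | ∀ e : Finset (Fin n), e.card = k - 1 →
          t.1 ∉ e → (isEdge x (insert t.1 e) ↔ isEdge x (insert t.2.1 (e.image t.2.2)))}) := by
        refine measure_mono ?_
        rintro x ⟨i, j, hij, f, hf, hx⟩
        simp only [Set.mem_iUnion]
        exact ⟨(i, j, f), by simp [hT, hij, hf], hx⟩
    _ ≤ ∑ t ∈ T, _ := measure_biUnion_finset_le _ _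
    _ ≤ ∑ _t ∈ T, B := Finset.sum_le_sum fun t ht => by
        have ht' := (Finset.mem_filter.1 ht).2
        exact hypergraphMeasure_perm_le hk p hp0 hp1 ht'.1 t.2.2 ht'.2
    _ ≤ _ := by
        rw [Finset.sum_const, nsmul_eq_mul]
        gcongr
        refine (Finset.card_le_univ T).trans_eq ?_
        simp [Fintype.card_prod, Fintype.card_perm]

/-- A binomial coefficient of bounded lower index has polynomial growth of full order. -/
theorem pow_div_le_choose_sub_three {n r : ℕ} (hn : 2 * (r + 2) ≤ n) :
    (n : ℝ) ^ r / (2 ^ r * r.factorial) ≤ ((n - 3).choose r : ℝ) := by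
  refine le_trans ?_ (Nat.pow_le_choose r (n - 3))
  rw [← div_div, ← div_pow]
  gcongr
  have h : n ≤ 2 * (n - 3 + 1 - r) := by omega
  have h' : (n : ℝ) ≤ 2 * ((n - 3 + 1 - r : ℕ) : ℝ) := by exact_mod_cast h
  linarith

/-- If `k ≥ 3`, `ω(n) → ∞` and `ω(n) n^{-(k-2)} log n ≤ p(n), 1 - p(n)`, then for every
`K > 0`, for all large `n`, the probability that `H(n,p;k)` has two distinct vertices
with isomorphic links is at most `n^{-K}`. -/
theorem binomial_links_iso_prob_small (k : ℕ) (hk : 3 ≤ k) (ω : ℕ → ℝ)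
    (hω : Tendsto ω atTop atTop) (p : ℕ → ℝ)
    (hp : ∀ n, 0 < p n ∧ p n < 1)
    (hlb : ∀ n : ℕ, ω n * (n : ℝ) ^ (-((k : ℝ) - 2)) * Real.log n ≤ p n)
    (hub : ∀ n : ℕ, ω n * (n : ℝ) ^ (-((k : ℝ) - 2)) * Real.log n ≤ 1 - p n)
    (K : ℝ) (hK : 0 < K) :
    ∀ᶠ n : ℕ in atTop,
      hypergraphMeasure n k (p n)
        {ωc | ∃ i j : Fin n, i ≠ j ∧ LinksIso n k (isEdge ωc) i j}
        ≤ ENNReal.ofReal ((n : ℝ) ^ (-K)) := by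
  set r := k - 1 with hr
  set c : ℝ := 1 / (2 ^ r * r.factorial) with hc
  have hcpos : 0 < c := by positivity
  filter_upwards [hω.eventually_ge_atTop ((3 + K) / c), eventually_ge_atTop (2 * (r + 2))]
    with n hωn hn
  obtain ⟨hp0, hp1⟩ := hp n
  have hn1 : (1 : ℝ) ≤ n := by exact_mod_cast (by omega : 1 ≤ n)
  have hn0 : (0 : ℝ) < n := by linarith
  have hlog : 0 ≤ Real.log n := Real.log_nonneg hn1
  set q := ω n * (n : ℝ) ^ (-((k : ℝ) - 2)) * Real.log n with hq
  have hqle : q ≤ 2 * (p n * (1 - p n)) := by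
    have h1 := hlb n
    have h2 := hub n
    rcases le_total (p n) (1 / 2) with h | h <;> nlinarith
  have hchoose := pow_div_le_choose_sub_three hn
  have hωpos : 0 ≤ ω n := le_trans (by positivity) hωn
  have hqpos : 0 ≤ q := by positivity
  have hexponent : (n + 2 + K) * Real.log n ≤ q * ((n - 3).choose r : ℝ) := by
    have hpow : (n : ℝ) ^ (-((k : ℝ) - 2)) * (n : ℝ) ^ r = n := by
      rw [← Real.rpow_natCast, ← Real.rpow_add hn0, hr, Nat.cast_sub (by omega)]
      convert Real.rpow_one (n : ℝ) using 2
      push_cast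
      ring
    have hωc : 3 + K ≤ ω n * c := (div_le_iff₀ hcpos).1 hωn
    calc (n + 2 + K) * Real.log n ≤ ((ω n * c) * n) * Real.log n := by
          gcongr
          nlinarith
      _ = q * ((n : ℝ) ^ r / (2 ^ r * r.factorial)) := by
          rw [hq, hc]
          linear_combination -(ω n * Real.log n / (2 ^ r * r.factorial)) * hpow
      _ ≤ _ := by gcongr
  have hbase : 0 ≤ 1 - 2 * (p n * (1 - p n)) := by nlinarith [sq_nonneg (2 * p n - 1)]
  refine (hypergraphMeasure_exists_linksIso_le (by omega) (p n) hp0.le hp1.le).trans ?_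
  rw [← ENNReal.ofReal_pow hbase, ← ENNReal.ofReal_natCast,
    ← ENNReal.ofReal_mul (Nat.cast_nonneg _)]
  refine ENNReal.ofReal_le_ofReal ?_
  have hfact : ((n * (n * n.factorial) : ℕ) : ℝ) ≤ Real.exp ((n + 2) * Real.log n) := by
    have h1 : n * (n * n.factorial) ≤ n ^ (n + 2) := by
      calc n * (n * n.factorial) ≤ n * (n * n ^ n) := by gcongr; exact Nat.factorial_le_pow n
        _ = n ^ (n + 2) := by ring
    calc ((n * (n * n.factorial) : ℕ) : ℝ) ≤ (n : ℝ) ^ (n + 2) := by exact_mod_cast h1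
      _ = Real.exp ((n + 2) * Real.log n) := by
        rw [← Real.rpow_natCast, Real.rpow_def_of_pos hn0]
        push_cast
        ring_nf
  have hpowle : (1 - 2 * (p n * (1 - p n))) ^ (n - 3).choose r
      ≤ Real.exp (-(q * ((n - 3).choose r : ℝ))) := by
    calc _ ≤ Real.exp (-q) ^ (n - 3).choose r := by
          gcongr
          linarith [Real.add_one_le_exp (-q)]
      _ = _ := by
          rw [← Real.exp_nat_mul]
          ring_nf
  calc _ ≤ Real.exp ((n + 2) * Real.log n) * Real.exp (-(q * ((n - 3).choose r : ℝ))) := by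
        gcongr
    _ ≤ Real.exp (Real.log n * -K) := by
        rw [← Real.exp_add]
        refine Real.exp_le_exp.2 ?_
        linarith
    _ = (n : ℝ) ^ (-K) := by rw [Real.rpow_def_of_pos hn0]
end

section
/- Let k ≥ 3, n ≥ k + 4, and p ∈ [0,1]. In the binomial random k-uniform hypergraph H(n,p;k), the probability that there exist distinct vertices i ≠ j whose links H_i and H_j are isomorphic is at most n^4 · n! · (p^2 + (1-p)^2)^{C(n-4, k-1)}, where C(n-4,k-1) is the binomial coefficient. -/
open MeasureTheory Filter

open ProbabilityTheory (iIndepFun iIndepFun_pi)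

lemma isProbabilityMeasure_bernoulliMeasure {p : ℝ} (hp0 : 0 ≤ p) (hp1 : p ≤ 1) :
    IsProbabilityMeasure (bernoulliMeasure p) := by
  refine ⟨?_⟩
  simp only [bernoulliMeasure, Measure.coe_add, Measure.coe_smul, Pi.add_apply, Pi.smul_apply,
    measure_univ, smul_eq_mul, mul_one]
  rw [← ENNReal.ofReal_add hp0 (by linarith)]
  simp

/-- Two distinct coordinates of a product of Bernoulli measures agree with probability
`p² + (1-p)²`. -/
lemma pi_bernoulliMeasure_eval_eq {ι : Type*} [Fintype ι] {p : ℝ} (hp0 : 0 ≤ p) (hp1 : p ≤ 1)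
    {a b : ι} (hab : a ≠ b) :
    Measure.pi (fun _ : ι => bernoulliMeasure p) {ω | ω a = ω b}
      = ENNReal.ofReal (p ^ 2 + (1 - p) ^ 2) := by
  have := isProbabilityMeasure_bernoulliMeasure hp0 hp1
  set μ := Measure.pi (fun _ : ι => bernoulliMeasure p)
  have hind : iIndepFun (fun (i : ι) (ω : ι → Bool) => ω i) μ :=
    iIndepFun_pi (X := fun _ x => x) (fun _ => aemeasurable_id)
  have hmarg (i : ι) (s : Set Bool) :
      μ ((fun ω : ι → Bool => ω i) ⁻¹' s) = bernoulliMeasure p s :=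
    (measurePreserving_eval (fun _ : ι => bernoulliMeasure p) i).measure_preimage
      (MeasurableSet.of_discrete).nullMeasurableSet
  have hval (t : Bool) : μ ((fun ω : ι → Bool => ω a) ⁻¹' {t} ∩ (fun ω => ω b) ⁻¹' {t})
      = bernoulliMeasure p {t} * bernoulliMeasure p {t} := by
    rw [(hind.indepFun hab).measure_inter_preimage_eq_mul _ _ .of_discrete .of_discrete,
      hmarg, hmarg]
  have hset : {ω : ι → Bool | ω a = ω b} =
      ((fun ω : ι → Bool => ω a) ⁻¹' {true} ∩ (fun ω => ω b) ⁻¹' {true}) ∪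
      ((fun ω : ι → Bool => ω a) ⁻¹' {false} ∩ (fun ω => ω b) ⁻¹' {false}) := by
    ext ω
    simp only [Set.mem_ofPred_eq, Set.mem_union, Set.mem_inter_iff, Set.mem_preimage,
      Set.mem_singleton_iff]
    cases ω a <;> cases ω b <;> simp
  rw [hset, measure_union _ .of_discrete, hval, hval]
  · simp only [bernoulliMeasure, Measure.coe_add, Measure.coe_smul, Pi.add_apply, Pi.smul_apply,
      smul_eq_mul, Measure.dirac_apply]
    rw [ENNReal.ofReal_add (by positivity) (by positivity), ENNReal.ofReal_pow hp0,
      ENNReal.ofReal_pow (by linarith)]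
    simp [sq]
  · refine Set.disjoint_left.2 fun ω h₁ h₂ => ?_
    simp_all

/-- Agreement of `ω a` and `ω (φ a)` over a set of disjoint pairs `{a, φ a}` is independent. -/
lemma pi_bernoulliMeasure_forall_eval_eq {ι : Type*} [Fintype ι] [DecidableEq ι] {p : ℝ}
    (hp0 : 0 ≤ p) (hp1 : p ≤ 1) (φ : ι → ι) (hφ : φ.Injective) (A : Finset ι)
    (hA : ∀ a ∈ A, φ a ∉ A) :
    Measure.pi (fun _ : ι => bernoulliMeasure p) {ω | ∀ a ∈ A, ω a = ω (φ a)}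
      = ENNReal.ofReal (p ^ 2 + (1 - p) ^ 2) ^ A.card := by
  have := isProbabilityMeasure_bernoulliMeasure hp0 hp1
  induction A using Finset.induction_on with
  | empty => simp
  | insert a A ha ih =>
    have hind : iIndepFun (fun (i : ι) (ω : ι → Bool) => ω i)
        (Measure.pi (fun _ : ι => bernoulliMeasure p)) :=
      iIndepFun_pi (X := fun _ x => x) (fun _ => aemeasurable_id)
    have hdisj : Disjoint ({a, φ a} : Finset ι) (A ∪ A.image φ) := by
      rw [Finset.disjoint_left]
      intro x hx hx'
      simp only [Finset.mem_insert, Finset.mem_singleton, Finset.mem_union,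
        Finset.mem_image] at hx hx' hA
      rcases hx with rfl | rfl <;> rcases hx' with h | ⟨y, hy, hxy⟩
      · exact ha h
      · exact hA y (.inr hy) (.inl hxy)
      · exact hA a (.inl rfl) (.inr h)
      · exact ha (hφ hxy ▸ hy)
    have hpair := hind.indepFun_finset _ _ hdisj (fun i => measurable_pi_apply i)
    have hmul := hpair.measure_inter_preimage_eq_mul
      {ω | ω ⟨a, by simp⟩ = ω ⟨φ a, by simp⟩}
      {ω | ∀ x, ∀ hx : x ∈ A, ω ⟨x, by simp [hx]⟩
        = ω ⟨φ x, Finset.mem_union_right _ (Finset.mem_image_of_mem φ hx)⟩}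
      (Set.toFinite _).measurableSet (Set.toFinite _).measurableSet
    have hset : {ω : ι → Bool | ∀ x ∈ insert a A, ω x = ω (φ x)}
        = {ω | ω a = ω (φ a)} ∩ {ω | ∀ x ∈ A, ω x = ω (φ x)} := by
      ext ω
      simp
    rw [hset, Finset.card_insert_of_notMem ha, pow_succ']
    refine hmul.trans ?_
    congr 1
    · exact pi_bernoulliMeasure_eval_eq hp0 hp1 fun h =>
        hA a (by simp) (Finset.mem_insert.2 (.inl (Eq.symm h)))
    · exact ih fun x hx h => hA x (by simp [hx]) (by simp [h])

/-- The number of `k`-subsets of an `n`-set that contain a given point `i` and avoid two others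
is at least `C(n-4, k-1)`. -/
lemma choose_le_card_filter_mem_notMem {n k : ℕ} (hk : 1 ≤ k) {i j l : Fin n} (hij : i ≠ j)
    (hil : i ≠ l) :
    (n - 4).choose (k - 1) ≤ (Finset.univ.filter fun s : {s : Finset (Fin n) // s.card = k} =>
      i ∈ s.1 ∧ j ∉ s.1 ∧ l ∉ s.1).card := by
  set B : Finset (Fin n) := Finset.univ \ {i, j, l}
  have hB : n - 4 ≤ B.card := by
    have h₁ := Finset.le_card_sdiff ({i, j, l} : Finset (Fin n)) Finset.univ
    have h₂ : ({i, j, l} : Finset (Fin n)).card ≤ 3 := Finset.card_le_three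
    simp only [Finset.card_univ, Fintype.card_fin] at h₁
    change _ ≤ B.card at h₁
    omega
  have hBi : i ∉ B := by simp [B]
  have hBj : j ∉ B := by simp [B]
  have hBl : l ∉ B := by simp [B]
  calc (n - 4).choose (k - 1) ≤ B.card.choose (k - 1) := Nat.choose_le_choose _ hB
    _ = (B.powersetCard (k - 1)).card := (Finset.card_powersetCard _ _).symm
    _ ≤ _ := by
      refine Finset.card_le_card_of_surjOn (fun s => s.1.erase i) ?_
      intro e he
      obtain ⟨heB, hcard⟩ := Finset.mem_powersetCard.1 he
      have hie : i ∉ e := fun h => hBi (heB h)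
      refine ⟨⟨insert i e, ?_⟩, ?_, ?_⟩
      · rw [Finset.card_insert_of_notMem hie]
        omega
      · simp [hij.symm, hil.symm, mt (@heB j) hBj, mt (@heB l) hBl]
      · simp [hie]

/-- The permutation of the `k`-subsets induced by a permutation of the points. -/
def permSubsets {n k : ℕ} (f : Equiv.Perm (Fin n)) (s : {s : Finset (Fin n) // s.card = k}) :
    {s : Finset (Fin n) // s.card = k} :=
  ⟨s.1.image f, by rw [Finset.card_image_of_injective _ f.injective, s.2]⟩

lemma permSubsets_injective {n k : ℕ} (f : Equiv.Perm (Fin n)) :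
    (permSubsets (k := k) f).Injective := fun _ _ h =>
  Subtype.ext (Finset.image_injective f.injective (congrArg Subtype.val h))

lemma isEdge_coe {n k : ℕ} (ω : {s : Finset (Fin n) // s.card = k} → Bool)
    (s : {s : Finset (Fin n) // s.card = k}) : isEdge ω s.1 ↔ ω s = true :=
  ⟨fun ⟨_, h⟩ => h, fun h => ⟨s.2, h⟩⟩

/-- A fixed permutation moving `i` is a link isomorphism from `H_i` to `H_(f i)` with probability
at most `(p² + (1-p)²)^C(n-4, k-1)`. -/
lemma hypergraphMeasure_perm_link_iso_le {n k : ℕ} (hk : 1 ≤ k) {p : ℝ} (hp0 : 0 ≤ p)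
    (hp1 : p ≤ 1) (f : Equiv.Perm (Fin n)) {i : Fin n} (hi : i ≠ f i) :
    hypergraphMeasure n k p {ω | ∀ e : Finset (Fin n), e.card = k - 1 → i ∉ e →
        (isEdge ω (insert i e) ↔ isEdge ω (insert (f i) (e.image f)))}
      ≤ ENNReal.ofReal (p ^ 2 + (1 - p) ^ 2) ^ (n - 4).choose (k - 1) := by
  have hil : i ≠ f.symm i := fun h => hi (by rw [f.eq_symm_apply] at h; exact h.symm)
  set A := Finset.univ.filter fun s : {s : Finset (Fin n) // s.card = k} =>
      i ∈ s.1 ∧ f i ∉ s.1 ∧ f.symm i ∉ s.1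
  calc _ ≤ hypergraphMeasure n k p {ω | ∀ s ∈ A, ω s = ω (permSubsets f s)} := by
        refine measure_mono fun ω h s hs => ?_
        have his : i ∈ s.1 := (Finset.mem_filter.1 hs).2.1
        have hiff := h (s.1.erase i) (by rw [Finset.card_erase_of_mem his, s.2])
          (Finset.notMem_erase _ _)
        rw [← Finset.image_insert, Finset.insert_erase his] at hiff
        exact Bool.eq_iff_iff.2
          ((isEdge_coe ω s).symm.trans (hiff.trans (isEdge_coe ω (permSubsets f s))))
    _ = ENNReal.ofReal (p ^ 2 + (1 - p) ^ 2) ^ A.card := by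
        refine pi_bernoulliMeasure_forall_eval_eq hp0 hp1 _ (permSubsets_injective f) A ?_
        intro s hs hs'
        have his : i ∈ s.1 := (Finset.mem_filter.1 hs).2.1
        exact (Finset.mem_filter.1 hs').2.2.1 (Finset.mem_image_of_mem f his)
    _ ≤ _ := by
        refine pow_le_pow_right_of_le_one' ?_ (choose_le_card_filter_mem_notMem hk hi hil)
        rw [ENNReal.ofReal_le_one]
        nlinarith [mul_nonneg hp0 (sub_nonneg.2 hp1)]

/-- For `k ≥ 3` and `n ≥ k + 4`, the probability that `H(n,p;k)` has two distinct
vertices with isomorphic links is at most `n^4 · n! · (p² + (1-p)²)^{C(n-4,k-1)}`. -/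
theorem binomial_links_iso_prob_bound (n k : ℕ) (hk : 3 ≤ k) (hn : k + 4 ≤ n)
    (p : ℝ) (hp0 : 0 ≤ p) (hp1 : p ≤ 1) :
    hypergraphMeasure n k p
        {ωc | ∃ i j : Fin n, i ≠ j ∧ LinksIso n k (isEdge ωc) i j}
      ≤ ENNReal.ofReal ((n : ℝ) ^ 4 * (Nat.factorial n : ℝ) *
          (p ^ 2 + (1 - p) ^ 2) ^ (Nat.choose (n - 4) (k - 1))) := by

  have hq : 0 ≤ p ^ 2 + (1 - p) ^ 2 := by positivity
  set q := ENNReal.ofReal (p ^ 2 + (1 - p) ^ 2) ^ (n - 4).choose (k - 1) with hq_def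
  let S : Finset (Fin n × Equiv.Perm (Fin n)) := Finset.univ.filter fun x => x.1 ≠ x.2 x.1
  have hS : S.card ≤ n * n.factorial := by
    refine (Finset.card_le_univ S).trans_eq ?_
    simp [Fintype.card_perm]
  calc _ ≤ hypergraphMeasure n k p (⋃ x ∈ S, {ω | ∀ e : Finset (Fin n), e.card = k - 1 →
          x.1 ∉ e → (isEdge ω (insert x.1 e) ↔
            isEdge ω (insert (x.2 x.1) (e.image x.2)))}) := by
        refine measure_mono ?_
        rintro ω ⟨i, _, hij, f, rfl, h⟩
        exact Set.mem_biUnion (x := (i, f)) (by simpa [S] using hij) h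
    _ ≤ ∑ _x ∈ S, q := by
        refine (measure_biUnion_finset_le _ _).trans (Finset.sum_le_sum fun x hx => ?_)
        exact hypergraphMeasure_perm_link_iso_le (by omega) hp0 hp1 x.2 (Finset.mem_filter.1 hx).2
    _ = S.card * q := by simp
    _ ≤ ((n ^ 4 * n.factorial : ℕ) : ENNReal) * q := by
        gcongr
        exact hS.trans (Nat.mul_le_mul_right _ (Nat.le_self_pow (by norm_num) n))
    _ = _ := by
        rw [ENNReal.ofReal_mul (by positivity), hq_def, ENNReal.ofReal_pow hq]
        congr 1
        rw [← ENNReal.ofReal_natCast]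
        push_cast
        rfl
end

section
/- Fix an integer k ≥ 3 and a function ω(n) → ∞. If p = p(n) ∈ (0,1) satisfies p ≥ ω(n)·n^{-(k-2)}·log n and 1 - p ≥ ω(n)·n^{-(k-2)}·log n, then for all sufficiently large n, n^4 · n! · (p^2 + (1-p)^2)^{C(n-4,k-1)} ≤ n^{-ω(n)/k!}. -/
open Filter

/-- If both `p` and `1 - p` are at least `q`, then `p² + (1-p)² ≤ exp (-q)`. -/
lemma sq_add_one_sub_sq_le_exp {p q : ℝ} (hp₀ : 0 < p) (hp₁ : p < 1) (hq : q ≤ p)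
    (hq' : q ≤ 1 - p) : p ^ 2 + (1 - p) ^ 2 ≤ Real.exp (-q) := by
  refine le_trans ?_ (Real.add_one_le_exp (-q))
  rcases le_total p (1 / 2) with h | h <;> nlinarith

/-- For fixed `r`, a lower bound of order `n ^ r` on `(n - a).choose r`. -/
lemma half_pow_div_factorial_le_choose_sub {a r n : ℕ} (hn : 2 * (a + r) ≤ n) :
    ((n : ℝ) / 2) ^ r / (r.factorial : ℝ) ≤ ((n - a).choose r : ℝ) := by
  refine le_trans ?_ (Nat.pow_le_choose r (n - a))
  have h : (n : ℝ) / 2 ≤ ((n - a + 1 - r : ℕ) : ℝ) := by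
    rw [div_le_iff₀ two_pos]
    exact_mod_cast (by lia : n ≤ (n - a + 1 - r) * 2)
  gcongr

/-- For `k ≥ 3`, `ω(n) → ∞` and `p(n)` with `ω(n) n^{-(k-2)} log n ≤ p(n), 1 - p(n)`,
for all large `n` we have `n^4 · n! · (p² + (1-p)²)^{C(n-4,k-1)} ≤ n^{-ω(n)/k!}`. -/
theorem binomial_links_iso_calculation (k : ℕ) (hk : 3 ≤ k) (ω : ℕ → ℝ)
    (hω : Tendsto ω atTop atTop) (p : ℕ → ℝ)
    (hp : ∀ n, 0 < p n ∧ p n < 1)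
    (hlb : ∀ n : ℕ, ω n * (n : ℝ) ^ (-((k : ℝ) - 2)) * Real.log n ≤ p n)
    (hub : ∀ n : ℕ, ω n * (n : ℝ) ^ (-((k : ℝ) - 2)) * Real.log n ≤ 1 - p n) :
    ∀ᶠ n : ℕ in atTop,
      (n : ℝ) ^ 4 * (Nat.factorial n : ℝ) *
          (p n ^ 2 + (1 - p n) ^ 2) ^ (Nat.choose (n - 4) (k - 1))
        ≤ (n : ℝ) ^ (-(ω n) / (Nat.factorial k : ℝ)) := by
  set c : ℝ := 1 / (2 ^ (k - 1) * ((k - 1).factorial : ℝ)) with hc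
  have hc0 : 0 < c := by positivity
  have hlarge : ∀ᶠ n : ℕ in atTop, 2 / c ≤ (n : ℝ) :=
    tendsto_natCast_atTop_atTop.eventually_ge_atTop _
  filter_upwards [hω.eventually_ge_atTop (4 / c), hlarge,
    eventually_ge_atTop (2 * (4 + (k - 1)))] with n hωn hnc hnk
  have hn4 : (4 : ℝ) ≤ n := by exact_mod_cast (by lia : 4 ≤ n)
  have hn0 : (0 : ℝ) < n := by linarith
  have hlog : 0 ≤ Real.log n := Real.log_nonneg (by linarith)
  have hω0 : 0 ≤ ω n := le_trans (by positivity) hωn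
  rw [div_le_iff₀ hc0] at hωn hnc
  set q : ℝ := ω n * (n : ℝ) ^ (-((k : ℝ) - 2)) * Real.log n with hq
  have hchoose : ω n * Real.log n * (c * n) ≤ q * ((n - 4).choose (k - 1) : ℝ) := by
    have hpow : (n : ℝ) ^ (-((k : ℝ) - 2)) * (n : ℝ) ^ (k - 1) = n := by
      rw [← Real.rpow_natCast, ← Real.rpow_add hn0, Nat.cast_sub (by lia)]
      convert Real.rpow_one (n : ℝ) using 2
      push_cast
      ring
    calc ω n * Real.log n * (c * n)
        = q * (((n : ℝ) / 2) ^ (k - 1) / ((k - 1).factorial : ℝ)) := by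
          nth_rw 2 [← hpow]
          rw [hc, hq, div_pow]
          field_simp
      _ ≤ _ := by
          gcongr
          exact half_pow_div_factorial_le_choose_sub hnk
  have hfac : (n.factorial : ℝ) ≤ (n : ℝ) ^ n := by exact_mod_cast n.factorial_le_pow
  have hbase : (p n ^ 2 + (1 - p n) ^ 2) ^ (n - 4).choose (k - 1)
      ≤ Real.exp (-(ω n * Real.log n * (c * n))) := by
    refine (pow_le_pow_left₀ (by positivity)
      (sq_add_one_sub_sq_le_exp (hp n).1 (hp n).2 (hlb n) (hub n)) _).trans ?_
    rw [← Real.exp_nat_mul, Real.exp_le_exp]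
    linarith
  have hkfac : ω n / (k.factorial : ℝ) ≤ ω n :=
    div_le_self hω0 (by exact_mod_cast k.factorial_pos)
  have hexp : (4 + n : ℝ) - ω n * (c * n) ≤ -(ω n) / (k.factorial : ℝ) := by
    rw [neg_div]
    nlinarith
  calc (n : ℝ) ^ 4 * (n.factorial : ℝ) *
        (p n ^ 2 + (1 - p n) ^ 2) ^ (n - 4).choose (k - 1)
      ≤ (n : ℝ) ^ 4 * (n : ℝ) ^ n * Real.exp (-(ω n * Real.log n * (c * n))) := by
        gcongr
    _ = (n : ℝ) ^ ((4 + n : ℝ) - ω n * (c * n)) := by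
        rw [← pow_add, ← Real.rpow_natCast, Real.rpow_def_of_pos hn0,
          Real.rpow_def_of_pos hn0, ← Real.exp_add]
        push_cast
        ring_nf
    _ ≤ _ := Real.rpow_le_rpow_of_exponent_le (by linarith) hexp
end

section
/- Fix an integer k ≥ 3 and a function ω(n) → ∞, and suppose p = p(n) ∈ (0,1) satisfies p ≥ ω(n)·n^{-(k-2)}·log n and 1 - p ≥ ω(n)·n^{-(k-2)}·log n. Then with probability tending to 1 as n → ∞, the only automorphism of the binomial random k-uniform hypergraph H(n,p;k) is the identity. -/
open MeasureTheory Filter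

/-- Under a product measure, the probability that the coordinates `a i` and `b i` agree for all `i`,
where all these coordinates are distinct. -/
lemma measure_pi_forall_eq_le {E ι α : Type*} [Fintype E] [Fintype ι] [Fintype α]
    [MeasurableSpace α] [MeasurableSingletonClass α] (μ : Measure α) [IsProbabilityMeasure μ]
    (a b : ι → E) (hab : Function.Injective (Sum.elim a b)) :
    Measure.pi (fun _ : E => μ) {x | ∀ i, x (a i) = x (b i)} ≤
      (∑ c, μ {c} ^ 2) ^ Fintype.card ι := by
  classical
  have hind : ProbabilityTheory.iIndepFun (fun (s : ι ⊕ ι) (x : E → α) => x (Sum.elim a b s))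
      (Measure.pi fun _ : E => μ) :=
    (ProbabilityTheory.iIndepFun_pi (X := fun _ : E => (id : α → α))
      (fun _ => aemeasurable_id)).precomp hab
  have hev : ∀ (e : E) (c : α), Measure.pi (fun _ : E => μ) ((fun x : E → α => x e) ⁻¹' {c})
      = μ {c} := fun e c =>
    (measurePreserving_eval (fun _ : E => μ) e).measure_preimage
      (measurableSet_singleton c).nullMeasurableSet
  have hc : ∀ c : ι → α, Measure.pi (fun _ : E => μ)
      (⋂ s : ι ⊕ ι, (fun x : E → α => x (Sum.elim a b s)) ⁻¹' {Sum.elim c c s})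
      = ∏ i, μ {c i} ^ 2 := by
    intro c
    rw [hind.meas_iInter fun s => ⟨_, measurableSet_singleton _, rfl⟩]
    simp only [hev, Fintype.prod_sum_type, Sum.elim_inl, Sum.elim_inr, sq, Finset.prod_mul_distrib]
  calc Measure.pi (fun _ : E => μ) {x | ∀ i, x (a i) = x (b i)}
      ≤ Measure.pi (fun _ : E => μ) (⋃ c : ι → α,
          ⋂ s : ι ⊕ ι, (fun x : E → α => x (Sum.elim a b s)) ⁻¹' {Sum.elim c c s}) := by
        refine measure_mono fun x hx => Set.mem_iUnion.2 ⟨fun i => x (a i), ?_⟩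
        simpa [Sum.forall] using fun i => (hx i).symm
    _ ≤ ∑ c : ι → α, ∏ i, μ {c i} ^ 2 := by
        refine (measure_iUnion_fintype_le _ _).trans_eq ?_
        simp only [hc]
    _ = (∑ c, μ {c} ^ 2) ^ Fintype.card ι := by
        rw [← Fintype.piFinset_univ,
          ← Finset.prod_univ_sum (fun _ => Finset.univ) fun (_ : ι) c => μ {c} ^ 2]
        simp

lemma isProbabilityMeasure_bernoulliMeasure_s4 {p : ℝ} (h0 : 0 ≤ p) (h1 : p ≤ 1) :
    IsProbabilityMeasure (bernoulliMeasure p) := by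
  constructor
  simp [bernoulliMeasure, ← ENNReal.ofReal_add h0 (sub_nonneg.2 h1)]

lemma sum_bernoulliMeasure_sq {p : ℝ} (h0 : 0 ≤ p) (h1 : p ≤ 1) :
    ∑ c, bernoulliMeasure p {c} ^ 2 = ENNReal.ofReal (1 - 2 * p * (1 - p)) := by
  have h1' := sub_nonneg.2 h1
  simp only [bernoulliMeasure, Fintype.sum_bool, Measure.add_apply, Measure.smul_apply,
    smul_eq_mul, Measure.dirac_apply, Set.indicator_apply, Set.mem_singleton_iff]
  simp only [reduceCtorEq, if_true, if_false, Pi.one_apply, mul_one, mul_zero, add_zero, zero_add]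
  rw [← ENNReal.ofReal_pow h0, ← ENNReal.ofReal_pow h1', ← ENNReal.ofReal_add (sq_nonneg _)
    (sq_nonneg _)]
  ring_nf

/-- The probability that a fixed non-identity permutation is an automorphism. -/
lemma hypergraphMeasure_isAut_le {n k : ℕ} (hk : 1 ≤ k) {p : ℝ} (h0 : 0 ≤ p) (h1 : p ≤ 1)
    {f : Equiv.Perm (Fin n)} (hf : f ≠ Equiv.refl (Fin n)) :
    hypergraphMeasure n k p {x | ∀ e : Finset (Fin n), isEdge x e ↔ isEdge x (e.image f)} ≤
      ENNReal.ofReal (1 - 2 * p * (1 - p)) ^ (n - 2).choose (k - 1) := by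
  have := isProbabilityMeasure_bernoulliMeasure_s4 h0 h1
  obtain ⟨u, hu⟩ : ∃ u, f u ≠ u := by
    by_contra! h
    exact hf (Equiv.ext h)
  set w := f.symm u with hw
  have hfw : f w = u := f.apply_symm_apply u
  have hwu : u ≠ w := fun h => hu (by rw [← h] at hfw; exact hfw)
  let V : Finset (Fin n) := Finset.univ \ {u, w}
  have hV : V.card = n - 2 := by
    rw [Finset.card_sdiff_of_subset (Finset.subset_univ _), Finset.card_pair hwu]; simp
  let ι := {S : Finset (Fin n) // S ∈ V.powersetCard (k - 1)}
  have hι : Fintype.card ι = (n - 2).choose (k - 1) := by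
    rw [Fintype.card_coe, Finset.card_powersetCard, hV]
  have hu' : ∀ S : ι, u ∉ S.1 := fun S h => by
    simpa [V] using (Finset.mem_powersetCard.1 S.2).1 h
  have hw' : ∀ S : ι, w ∉ S.1 := fun S h => by
    simpa [V] using (Finset.mem_powersetCard.1 S.2).1 h
  have hcard : ∀ S : ι, (insert u S.1).card = k := fun S => by
    rw [Finset.card_insert_of_notMem (hu' S), (Finset.mem_powersetCard.1 S.2).2]; omega
  let a : ι → {s : Finset (Fin n) // s.card = k} := fun S => ⟨insert u S.1, hcard S⟩
  let b : ι → {s : Finset (Fin n) // s.card = k} := fun S =>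
    ⟨(insert u S.1).image f, by rw [Finset.card_image_of_injective _ f.injective, hcard]⟩
  have hinj : ∀ S T : ι, insert u S.1 = insert u T.1 → S = T := fun S T h => by
    apply Subtype.ext
    rw [← Finset.erase_insert (hu' S), h, Finset.erase_insert (hu' T)]
  have hab : Function.Injective (Sum.elim a b) := by
    refine Function.Injective.sumElim (fun S T h => hinj S T (congrArg Subtype.val h))
      (fun S T h => hinj S T (Finset.image_injective f.injective (congrArg Subtype.val h)))
      fun S T h => ?_
    have hmem : u ∈ (insert u T.1).image f := by
      rw [← show insert u S.1 = (insert u T.1).image f from congrArg Subtype.val h]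
      exact Finset.mem_insert_self _ _
    obtain ⟨x, hx, hxu⟩ := Finset.mem_image.1 hmem
    obtain rfl : x = w := f.injective (hxu.trans hfw.symm)
    rcases Finset.mem_insert.1 hx with h | h
    · exact hwu h.symm
    · exact hw' T h
  rw [← hι, ← sum_bernoulliMeasure_sq h0 h1]
  refine (measure_mono fun x hx => ?_).trans
    (measure_pi_forall_eq_le (bernoulliMeasure p) a b hab)
  intro S
  have h := hx (insert u S.1)
  have e1 : isEdge x (insert u S.1) ↔ x (a S) = true := ⟨fun h => h.2, fun h => ⟨_, h⟩⟩
  have e2 : isEdge x ((insert u S.1).image f) ↔ x (b S) = true := ⟨fun h => h.2, fun h => ⟨_, h⟩⟩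
  rw [e1, e2] at h
  exact Bool.eq_iff_iff.2 h

/-- The union bound over all non-identity permutations. -/
lemma one_sub_le_hypergraphMeasure_rigid {n k : ℕ} (hk : 1 ≤ k) {p : ℝ} (h0 : 0 ≤ p)
    (h1 : p ≤ 1) :
    1 - n.factorial * ENNReal.ofReal (1 - 2 * p * (1 - p)) ^ (n - 2).choose (k - 1) ≤
      hypergraphMeasure n k p {x | ∀ f : Equiv.Perm (Fin n),
        (∀ e : Finset (Fin n), isEdge x e ↔ isEdge x (e.image f)) → f = Equiv.refl (Fin n)} := by
  classical
  have := isProbabilityMeasure_bernoulliMeasure_s4 h0 h1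
  have : IsProbabilityMeasure (hypergraphMeasure n k p) := by
    unfold hypergraphMeasure; infer_instance
  set G := {x : {s : Finset (Fin n) // s.card = k} → Bool | ∀ f : Equiv.Perm (Fin n),
        (∀ e : Finset (Fin n), isEdge x e ↔ isEdge x (e.image f)) → f = Equiv.refl (Fin n)}
  have hle : hypergraphMeasure n k p Gᶜ ≤
      n.factorial * ENNReal.ofReal (1 - 2 * p * (1 - p)) ^ (n - 2).choose (k - 1) := by
    calc hypergraphMeasure n k p Gᶜ
        ≤ hypergraphMeasure n k p (⋃ f : Equiv.Perm (Fin n), {x | f ≠ Equiv.refl (Fin n) ∧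
            ∀ e : Finset (Fin n), isEdge x e ↔ isEdge x (e.image f)}) := by
          refine measure_mono fun x hx => ?_
          simp only [G, Set.mem_compl_iff, Set.mem_ofPred_eq, not_forall] at hx
          obtain ⟨f, h, hne⟩ := hx
          exact Set.mem_iUnion.2 ⟨f, hne, h⟩
      _ ≤ ∑ f : Equiv.Perm (Fin n), hypergraphMeasure n k p {x | f ≠ Equiv.refl (Fin n) ∧
            ∀ e : Finset (Fin n), isEdge x e ↔ isEdge x (e.image f)} :=
          measure_iUnion_fintype_le _ _
      _ ≤ ∑ _f : Equiv.Perm (Fin n),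
            ENNReal.ofReal (1 - 2 * p * (1 - p)) ^ (n - 2).choose (k - 1) := by
          refine Finset.sum_le_sum fun f _ => ?_
          by_cases hf : f = Equiv.refl (Fin n)
          · simp [hf]
          · exact (measure_mono fun x hx => hx.2).trans (hypergraphMeasure_isAut_le hk h0 h1 hf)
      _ = _ := by simp [Fintype.card_perm]
  have hG : hypergraphMeasure n k p Gᶜ = 1 - hypergraphMeasure n k p G :=
    prob_compl_eq_one_sub (Set.toFinite G).measurableSet
  rw [hG] at hle
  exact tsub_le_iff_tsub_le.1 hle

/-- A lower bound of order `n ^ (k - 1)` for the number of independent pairs. -/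
lemma pow_le_choose_sub_two {n k : ℕ} (hk : 1 ≤ k) (hn : 2 * k ≤ n) :
    (n : ℝ) ^ (k - 1) / (2 ^ (k - 1) * (k - 1).factorial) ≤ ((n - 2).choose (k - 1) : ℝ) := by
  refine le_trans ?_ (Nat.pow_le_choose (α := ℝ) (k - 1) (n - 2))
  rw [← div_div, ← div_pow]
  gcongr
  have : n ≤ 2 * (n - 2 + 1 - (k - 1)) := by omega
  have : (n : ℝ) ≤ 2 * ((n - 2 + 1 - (k - 1) : ℕ) : ℝ) := by exact_mod_cast this
  linarith

lemma factorial_mul_pow_le_exp_neg {n k : ℕ} (hk : 3 ≤ k) (hn : 2 * k ≤ n) {p w : ℝ}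
    (hp0 : 0 < p) (hp1 : p < 1)
    (hw : 2 * (2 ^ (k - 1) * (k - 1).factorial) ≤ w)
    (hlb : w * (n : ℝ) ^ (-((k : ℝ) - 2)) * Real.log n ≤ p)
    (hub : w * (n : ℝ) ^ (-((k : ℝ) - 2)) * Real.log n ≤ 1 - p) :
    n.factorial * (1 - 2 * p * (1 - p)) ^ (n - 2).choose (k - 1) ≤ Real.exp (-n) := by
  have hn0 : (0 : ℝ) < n := by exact_mod_cast (by omega : 0 < n)
  have hlog : 1 ≤ Real.log n := by
    rw [Real.le_log_iff_exp_le hn0]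
    have h6 : (6 : ℝ) ≤ n := by exact_mod_cast (by omega : 6 ≤ n)
    linarith [Real.exp_one_lt_d9]
  set D : ℝ := 2 ^ (k - 1) * (k - 1).factorial with hD
  have hD0 : 0 < D := by positivity
  set q : ℝ := w * (n : ℝ) ^ (-((k : ℝ) - 2)) * Real.log n with hq
  have hq0 : 0 ≤ q := by
    have : 0 ≤ w := by linarith
    positivity
  have hqp : q ≤ 2 * p * (1 - p) := by
    rcases le_total p (1 / 2) with h | h <;> nlinarith
  have hpow : (n : ℝ) ^ (-((k : ℝ) - 2)) * (n : ℝ) ^ (k - 1) = n := by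
    rw [← Real.rpow_natCast, ← Real.rpow_add hn0, Nat.cast_sub (by omega)]
    convert Real.rpow_one (n : ℝ) using 2
    push_cast; ring
  have hexp : 2 * (n * Real.log n) ≤ 2 * p * (1 - p) * (n - 2).choose (k - 1) :=
    calc 2 * (n * Real.log n) ≤ w / D * (n * Real.log n) := by
          gcongr
          rw [le_div_iff₀ hD0]; exact hw
      _ = q * ((n : ℝ) ^ (k - 1) / D) := by
          rw [hq]; nth_rewrite 1 [← hpow]; ring
      _ ≤ _ := by
          gcongr
          exact pow_le_choose_sub_two (by omega) hn
  have hbase : 0 ≤ 1 - 2 * p * (1 - p) := by nlinarith [sq_nonneg (2 * p - 1)]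
  calc n.factorial * (1 - 2 * p * (1 - p)) ^ (n - 2).choose (k - 1)
      ≤ Real.exp (n * Real.log n) *
          Real.exp (-(2 * p * (1 - p))) ^ (n - 2).choose (k - 1) := by
        gcongr
        · rw [mul_comm, Real.exp_mul, Real.exp_log hn0, Real.rpow_natCast]
          exact_mod_cast Nat.factorial_le_pow n
        · linarith [Real.add_one_le_exp (-(2 * p * (1 - p)))]
    _ = Real.exp (n * Real.log n - 2 * p * (1 - p) * (n - 2).choose (k - 1)) := by
        rw [← Real.exp_nat_mul, ← Real.exp_add]; ring_nf
    _ ≤ Real.exp (-n) := by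
        gcongr
        nlinarith

/-- For `k ≥ 3`, `ω(n) → ∞` and `p(n)` with `ω(n) n^{-(k-2)} log n ≤ p(n), 1 - p(n)`,
with probability tending to `1` the only automorphism of `H(n,p;k)` is the identity. -/
theorem binomial_rigid_whp (k : ℕ) (hk : 3 ≤ k) (ω : ℕ → ℝ)
    (hω : Tendsto ω atTop atTop) (p : ℕ → ℝ)
    (hp : ∀ n, 0 < p n ∧ p n < 1)
    (hlb : ∀ n : ℕ, ω n * (n : ℝ) ^ (-((k : ℝ) - 2)) * Real.log n ≤ p n)
    (hub : ∀ n : ℕ, ω n * (n : ℝ) ^ (-((k : ℝ) - 2)) * Real.log n ≤ 1 - p n) :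
    Tendsto (fun n : ℕ =>
        hypergraphMeasure n k (p n)
          {ωc | ∀ f : Equiv.Perm (Fin n),
            (∀ e : Finset (Fin n), isEdge ωc e ↔ isEdge ωc (e.image f)) →
              f = Equiv.refl (Fin n)})
      atTop (nhds 1) := by
  have hlim : Tendsto (fun n : ℕ => 1 - ENNReal.ofReal (Real.exp (-(n : ℝ)))) atTop (nhds 1) := by
    have h := ENNReal.tendsto_ofReal
      (Real.tendsto_exp_neg_atTop_nhds_zero.comp (tendsto_natCast_atTop_atTop (R := ℝ)))
    simpa using ENNReal.Tendsto.sub (tendsto_const_nhds (x := (1 : ENNReal))) h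
      (Or.inl ENNReal.one_ne_top)
  have hprob : ∀ n, IsProbabilityMeasure (hypergraphMeasure n k (p n)) := fun n => by
    have := isProbabilityMeasure_bernoulliMeasure_s4 (hp n).1.le (hp n).2.le
    unfold hypergraphMeasure
    infer_instance
  refine tendsto_of_tendsto_of_tendsto_of_le_of_le' hlim tendsto_const_nhds ?_
    (Eventually.of_forall fun n => prob_le_one)
  filter_upwards [eventually_ge_atTop (2 * k),
    hω.eventually_ge_atTop (2 * (2 ^ (k - 1) * (k - 1).factorial))] with n hn hw
  have hnonneg : 0 ≤ 1 - 2 * p n * (1 - p n) := by nlinarith [sq_nonneg (2 * p n - 1)]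
  refine le_trans (tsub_le_tsub_left ?_ 1)
    (one_sub_le_hypergraphMeasure_rigid (by omega) (hp n).1.le (hp n).2.le)
  rw [← ENNReal.ofReal_pow hnonneg, ← ENNReal.ofReal_natCast,
    ← ENNReal.ofReal_mul (Nat.cast_nonneg _)]
  exact ENNReal.ofReal_le_ofReal
    (factorial_mul_pow_le_exp_neg hk hn (hp n).1 (hp n).2 hw (hlb n) (hub n))
end

section
/- Fix integers r ≥ 2 and k ≥ 3, set ρ = (r-1)(k-1) and ℓ₀ = ⌈100·log log n / log ρ⌉. Then with probability tending to 1 as n → ∞ (along integers n with k dividing rn), the uniform random r-regular k-uniform hypergraph H = H(n,r;k) satisfies: for every set S ⊆ [n] with |S| ≤ 2ℓ₀, the number of edges of H entirely contained in S is at most |S|/(k-1), i.e. (k-1)·e_H(S) ≤ |S|. -/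
open Filter

/-- `E` is the edge set of an `r`-regular `k`-uniform hypergraph on `[n]`:
every edge has `k` vertices and every vertex lies in exactly `r` edges. -/
def IsRegularHypergraph (n k r : ℕ) (E : Finset (Finset (Fin n))) : Prop :=
  (∀ e ∈ E, e.card = k) ∧ ∀ v : Fin n, (E.filter (fun e => v ∈ e)).card = r

open Classical in
/-- The (finite) set of all `r`-regular `k`-uniform hypergraphs on `[n]`. -/
noncomputable def regularHypergraphs (n k r : ℕ) : Finset (Finset (Finset (Fin n))) :=
  Finset.univ.filter (fun E => IsRegularHypergraph n k r E)

open Classical in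
/-- The probability that a uniformly random `r`-regular `k`-uniform hypergraph on `[n]`
satisfies the property `P`. -/
noncomputable def regularProb (n k r : ℕ) (P : Finset (Finset (Fin n)) → Prop) : ℝ :=
  (((regularHypergraphs n k r).filter P).card : ℝ) / ((regularHypergraphs n k r).card : ℝ)

/-- The filter of large integers `n` such that `k` divides `rn` and an `r`-regular
`k`-uniform hypergraph on `[n]` exists. -/
def regularFilter (k r : ℕ) : Filter ℕ :=
  atTop ⊓ Filter.principal {n | k ∣ r * n ∧ (regularHypergraphs n k r).Nonempty}

/-- The hypergraph obtained from `E` by exchanging the vertex `v` of the edge `e` with the vertex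
`x` of the edge `g`. -/
def swapEdges {n : ℕ} (E : Finset (Finset (Fin n))) (e g : Finset (Fin n)) (v x : Fin n) :
    Finset (Finset (Fin n)) :=
  (E \ {e, g}) ∪ {insert x (e.erase v), insert v (g.erase x)}

/-- No edge of `E` meets both `e` and `g`. -/
def FarApart {n : ℕ} (E : Finset (Finset (Fin n))) (e g : Finset (Fin n)) : Prop :=
  ∀ h ∈ E, Disjoint h e ∨ Disjoint h g

open Classical in
/-- The regular hypergraphs that contain `F` and have a further edge containing `U`. -/
noncomputable def regularExtensions (n k r : ℕ) (F : Finset (Finset (Fin n)))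
    (U : Finset (Fin n)) : Finset (Finset (Finset (Fin n))) :=
  (regularHypergraphs n k r).filter (fun E => F ⊆ E ∧ ∃ e ∈ E, e ∉ F ∧ U ⊆ e)

lemma mem_regularHypergraphs {n k r : ℕ} {E : Finset (Finset (Fin n))} :
    E ∈ regularHypergraphs n k r ↔ IsRegularHypergraph n k r E := by
  classical
  simp [regularHypergraphs]

lemma mem_regularExtensions {n k r : ℕ} {F E : Finset (Finset (Fin n))} {U : Finset (Fin n)} :
    E ∈ regularExtensions n k r F U ↔
      IsRegularHypergraph n k r E ∧ F ⊆ E ∧ ∃ e ∈ E, e ∉ F ∧ U ⊆ e := by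
  classical
  simp [regularExtensions, mem_regularHypergraphs]

section Swap

variable {n k r : ℕ} {E : Finset (Finset (Fin n))} {e g : Finset (Fin n)} {v x : Fin n}

lemma FarApart.disjoint (hfar : FarApart E e g) (he : e ∈ E) : Disjoint e g := by
  rcases hfar e he with h | h
  · rw [disjoint_self] at h
    simp [h]
  · exact h

lemma FarApart.symm (hfar : FarApart E e g) : FarApart E g e := fun h hh => (hfar h hh).symm

lemma FarApart.insert_erase_notMem (hfar : FarApart E e g) (hcard : 2 ≤ e.card) (hx : x ∈ g) :
    insert x (e.erase v) ∉ E := by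
  intro hmem
  obtain ⟨y, hy, hyv⟩ := Finset.exists_mem_ne (by omega : 1 < e.card) v
  rcases hfar _ hmem with h | h
  · exact Finset.disjoint_left.mp h (by simp [hy, hyv]) hy
  · exact Finset.disjoint_left.mp h (by simp) hx

lemma insert_erase_insert_erase (hv : v ∈ e) (hx : x ∉ e) :
    insert v ((insert x (e.erase v)).erase x) = e := by
  rw [Finset.erase_insert (by simp [hx]), Finset.insert_erase hv]

lemma swapEdges_swapEdges (he : e ∈ E) (hg : g ∈ E) (hfar : FarApart E e g) (hv : v ∈ e)
    (hx : x ∈ g) (hce : 2 ≤ e.card) (hcg : 2 ≤ g.card) :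
    swapEdges (swapEdges E e g v x) (insert x (e.erase v)) (insert v (g.erase x)) x v = E := by
  have hd := hfar.disjoint he
  have hxe : x ∉ e := fun h => Finset.disjoint_left.mp hd h hx
  have hvg : v ∉ g := fun h => Finset.disjoint_left.mp hd hv h
  have he' := hfar.insert_erase_notMem (v := v) hce hx
  have hg' := hfar.symm.insert_erase_notMem (v := x) hcg hv
  unfold swapEdges
  rw [insert_erase_insert_erase hv hxe, insert_erase_insert_erase hx hvg]
  ext h
  simp only [Finset.mem_union, Finset.mem_sdiff, Finset.mem_insert, Finset.mem_singleton]
  constructor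
  · rintro (⟨⟨h1, -⟩ | h1, h2⟩ | rfl | rfl)
    · exact h1
    · exact absurd h1 h2
    · exact he
    · exact hg
  · intro hh
    by_cases h1 : h = e ∨ h = g
    · exact Or.inr h1
    · refine Or.inl ⟨Or.inl ⟨hh, h1⟩, ?_⟩
      rintro (rfl | rfl)
      · exact he' hh
      · exact hg' hh

lemma IsRegularHypergraph.swapEdges (hE : IsRegularHypergraph n k r E) (hk : 2 ≤ k) (he : e ∈ E)
    (hg : g ∈ E) (hfar : FarApart E e g) (hv : v ∈ e) (hx : x ∈ g) :
    IsRegularHypergraph n k r (swapEdges E e g v x) := by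
  have hd := hfar.disjoint he
  have hce := hE.1 e he
  have hcg := hE.1 g hg
  have hxe : x ∉ e := fun h => Finset.disjoint_left.mp hd h hx
  have hvg : v ∉ g := fun h => Finset.disjoint_left.mp hd hv h
  have hvx : v ≠ x := fun h => hxe (h ▸ hv)
  have he' := hfar.insert_erase_notMem (v := v) (by omega) hx
  have hg' := hfar.symm.insert_erase_notMem (v := x) (by omega) hv
  have hne : e ≠ g := fun h => hxe (h ▸ hx)
  have hne' : insert x (e.erase v) ≠ insert v (g.erase x) := by
    intro h
    have : x ∈ insert v (g.erase x) := h ▸ Finset.mem_insert_self _ _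
    simp [hvx.symm] at this
  refine ⟨?_, fun w => ?_⟩
  · intro h hh
    simp only [_root_.swapEdges, Finset.mem_union, Finset.mem_sdiff, Finset.mem_insert,
      Finset.mem_singleton] at hh
    rcases hh with ⟨hh, -⟩ | rfl | rfl
    · exact hE.1 h hh
    · rw [Finset.card_insert_of_notMem (by simp [hxe]), Finset.card_erase_of_mem hv]
      omega
    · rw [Finset.card_insert_of_notMem (by simp [hvg]), Finset.card_erase_of_mem hx]
      omega
  · have hsub : ({e, g} : Finset (Finset (Fin n))) ⊆ E := by
      simp [Finset.insert_subset_iff, he, hg]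
    have hdisj : Disjoint (E \ {e, g}) {insert x (e.erase v), insert v (g.erase x)} := by
      rw [Finset.disjoint_right]
      simp only [Finset.mem_insert, Finset.mem_singleton, Finset.mem_sdiff]
      rintro h (rfl | rfl) ⟨h1, -⟩
      · exact he' h1
      · exact hg' h1
    rw [← hE.2 w, Finset.card_filter, Finset.card_filter, _root_.swapEdges,
      Finset.sum_union hdisj, ← Finset.sum_sdiff hsub, Finset.sum_pair hne, Finset.sum_pair hne']
    congr 1
    by_cases hwv : w = v
    · subst hwv
      simp [hv, hvg, hvx]
    · by_cases hwx : w = x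
      · subst hwx
        simp [hx, hxe, hvx.symm]
      · simp [hwv, hwx]

lemma swapEdges_right_injective {g₁ g₂ : Finset (Fin n)} {x₁ x₂ : Fin n}
    (he : e ∈ E) (hv : v ∈ e) (hce : 2 ≤ e.card)
    (h₁ : g₁ ∈ E) (hfar₁ : FarApart E e g₁) (hx₁ : x₁ ∈ g₁)
    (h : swapEdges E e g₁ v x₁ = swapEdges E e g₂ v x₂) : g₁ = g₂ := by
  by_contra hne
  have hge : g₁ ≠ e := by
    rintro rfl
    exact Finset.disjoint_left.mp (hfar₁.disjoint he) hx₁ hx₁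
  have hmem : g₁ ∈ swapEdges E e g₂ v x₂ := by
    simp [swapEdges, h₁, hge, hne]
  have hv₁ : v ∉ g₁ := Finset.disjoint_left.mp (hfar₁.disjoint he) hv
  rw [← h] at hmem
  simp only [swapEdges, Finset.mem_union, Finset.mem_sdiff, Finset.mem_insert,
    Finset.mem_singleton, or_true, not_true_eq_false, and_false, false_or] at hmem
  rcases hmem with h' | h'
  · exact hfar₁.insert_erase_notMem (v := v) hce hx₁ (h' ▸ h₁)
  · exact hv₁ (h' ▸ Finset.mem_insert_self _ _)

end Swap

lemma IsRegularHypergraph.mul_card {n k r : ℕ} {E : Finset (Finset (Fin n))}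
    (hE : IsRegularHypergraph n k r E) : k * E.card = r * n := by
  have h := Finset.sum_card_bipartiteAbove_eq_sum_card_bipartiteBelow
    (s := (Finset.univ : Finset (Fin n))) (t := E) (fun v e => v ∈ e)
  have h1 : ∀ v ∈ (Finset.univ : Finset (Fin n)),
      (Finset.bipartiteAbove (fun v e => v ∈ e) E v).card = r := fun v _ => hE.2 v
  have h2 : ∀ e ∈ E,
      (Finset.bipartiteBelow (fun v e => v ∈ e) (Finset.univ : Finset (Fin n)) e).card = k := by
    intro e he
    simpa [Finset.bipartiteBelow] using hE.1 e he
  rw [Finset.sum_congr rfl h1, Finset.sum_congr rfl h2] at h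
  simp only [Finset.sum_const, Finset.card_univ, Fintype.card_fin, smul_eq_mul] at h
  linarith

lemma IsRegularHypergraph.card_filter_not_disjoint_le {n k r : ℕ} {E : Finset (Finset (Fin n))}
    (hE : IsRegularHypergraph n k r E) (e : Finset (Fin n)) :
    (E.filter (fun h => ¬ Disjoint h e)).card ≤ e.card * r := by
  refine le_trans (Finset.card_le_card (t := e.biUnion fun v => E.filter (fun h => v ∈ h)) ?_)
    (Finset.card_biUnion_le_card_mul _ _ _ fun v _ => (hE.2 v).le)
  intro h hh
  simp only [Finset.mem_filter, Finset.not_disjoint_iff] at hh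
  obtain ⟨h1, v, h2, h3⟩ := hh
  simp only [Finset.mem_biUnion, Finset.mem_filter]
  exact ⟨v, h3, h1, h2⟩

open Classical in
lemma IsRegularHypergraph.card_le_card_farApart {n k r m : ℕ} {E F : Finset (Finset (Fin n))}
    {e : Finset (Fin n)} (hE : IsRegularHypergraph n k r E) (hk : 0 < k) (he : e ∈ E)
    (hm : k * (m + F.card + k * r * (k * r)) ≤ r * n) :
    m ≤ (E.filter (fun g => g ∉ F ∧ FarApart E e g)).card := by
  have hcard : m + F.card + k * r * (k * r) ≤ E.card := by
    rw [← hE.mul_card] at hm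
    exact Nat.le_of_mul_le_mul_left hm hk
  set N := (E.filter (fun h => ¬ Disjoint h e)).biUnion
    (fun h => E.filter (fun g => ¬ Disjoint g h)) with hN
  have hNcard : N.card ≤ k * r * (k * r) := by
    refine le_trans (Finset.card_biUnion_le_card_mul _ _ (k * r) fun h hh => ?_)
      (Nat.mul_le_mul_right _ ?_)
    · exact (hE.card_filter_not_disjoint_le h).trans_eq
        (by rw [hE.1 h (Finset.mem_filter.mp hh).1])
    · exact (hE.card_filter_not_disjoint_le e).trans_eq (by rw [hE.1 e he])
  have hsub : E ⊆ E.filter (fun g => g ∉ F ∧ FarApart E e g) ∪ (F ∪ N) := by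
    intro g hg
    by_contra hcon
    rw [Finset.mem_union, Finset.mem_union, not_or, not_or] at hcon
    simp only [hN, Finset.mem_biUnion, Finset.mem_filter (p := fun g => g ∉ F ∧ FarApart E e g),
      Finset.mem_filter] at hcon
    obtain ⟨h1, h2, h3⟩ := hcon
    refine h1 ⟨hg, h2, fun h hh => ?_⟩
    by_contra! hc
    exact h3 ⟨h, ⟨hh, hc.1⟩, hg, fun h' => hc.2 h'.symm⟩
  have h1 := (Finset.card_le_card hsub).trans (Finset.card_union_le _ _)
  have h2 := Finset.card_union_le F N
  omega

lemma card_regularExtensions_insert_mul_le {n k r m : ℕ} {F : Finset (Finset (Fin n))}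
    {U : Finset (Fin n)} {v : Fin n} (hk : 2 ≤ k) (hU : U.Nonempty) (hvU : v ∉ U)
    (hm : k * (m + F.card + k * r * (k * r)) ≤ r * n) :
    (regularExtensions n k r F (insert v U)).card * m ≤
      (regularExtensions n k r F U).card * (r * r * k) := by
  classical
  obtain ⟨u, hu⟩ := hU
  refine Finset.card_mul_le_card_mul (fun E E' => ∃ e ∈ E, ∃ g ∈ E, ∃ x ∈ g,
    FarApart E e g ∧ insert v U ⊆ e ∧ E' = swapEdges E e g v x) ?_ ?_
  · intro E hE
    obtain ⟨hE, hFE, e, he, heF, hUe⟩ := mem_regularExtensions.mp hE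
    refine (hE.card_le_card_farApart (by omega) he hm).trans ?_
    have hv : v ∈ e := hUe (Finset.mem_insert_self _ _)
    have hce : 2 ≤ e.card := by rw [hE.1 e he]; exact hk
    have hne : ∀ g : Finset (Fin n), ∃ x, g ∈ E → x ∈ g := by
      intro g
      by_cases hg : g ∈ E
      · have : 0 < g.card := by rw [hE.1 g hg]; omega
        obtain ⟨x, hx⟩ := Finset.card_pos.mp this
        exact ⟨x, fun _ => hx⟩
      · exact ⟨v, fun h => absurd h hg⟩
    choose x hx using hne
    refine Finset.card_le_card_of_injOn (fun g => swapEdges E e g v (x g)) ?_ ?_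
    · intro g hg
      obtain ⟨hg, hgF, hfar⟩ := Finset.mem_filter.mp hg
      have hcg : 2 ≤ g.card := by rw [hE.1 g hg]; exact hk
      refine Finset.mem_coe.mpr (Finset.mem_bipartiteAbove _ |>.mpr
        ⟨mem_regularExtensions.mpr ⟨hE.swapEdges hk he hg hfar hv (hx g hg), ?_, ?_⟩,
          e, he, g, hg, x g, hx g hg, hfar, hUe, rfl⟩)
      · intro h hh
        have h1 : h ≠ e := fun h' => heF (h' ▸ hh)
        have h2 : h ≠ g := fun h' => hgF (h' ▸ hh)
        simp [swapEdges, hFE hh, h1, h2]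
      · refine ⟨insert (x g) (e.erase v), by simp [swapEdges],
          fun h => hfar.insert_erase_notMem hce (hx g hg) (hFE h), ?_⟩
        intro w hw
        have hwv : w ≠ v := fun h => hvU (h ▸ hw)
        simp [hwv, hUe (Finset.mem_insert_of_mem hw)]
    · intro g₁ h₁ g₂ h₂ h
      obtain ⟨hg₁, -, hfar₁⟩ := Finset.mem_filter.mp h₁
      exact swapEdges_right_injective he hv hce hg₁ hfar₁ (hx _ hg₁) h
  · intro E' hE'
    obtain ⟨hE', -, -⟩ := mem_regularExtensions.mp hE'
    obtain ⟨T, hTdef⟩ : ∃ T, T = (E'.filter (fun e => u ∈ e) ×ˢ E'.filter (fun e => v ∈ e)).biUnion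
      (fun p => p.1.image (fun x => swapEdges E' p.1 p.2 x v)) := ⟨_, rfl⟩
    have hT : T.card ≤ r * r * k := by
      rw [hTdef]
      refine le_trans (Finset.card_biUnion_le_card_mul _ _ k fun p hp => ?_) ?_
      · refine Finset.card_image_le.trans (hE'.1 _ ?_).le
        exact (Finset.mem_filter.mp (Finset.mem_product.mp hp).1).1
      · rw [Finset.card_product, hE'.2, hE'.2]
    refine (Finset.card_le_card ?_).trans hT
    intro E hE
    rw [Finset.mem_bipartiteBelow, mem_regularExtensions] at hE
    obtain ⟨⟨hE, -, -⟩, e, he, g, hg, x, hx, hfar, hUe, rfl⟩ := hE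
    have hv : v ∈ e := hUe (Finset.mem_insert_self _ _)
    have huv : u ≠ v := fun h => hvU (h ▸ hu)
    have hue : u ∈ e := hUe (Finset.mem_insert_of_mem hu)
    have hinv := swapEdges_swapEdges he hg hfar hv hx
      (by rw [hE.1 e he]; exact hk) (by rw [hE.1 g hg]; exact hk)
    have hx' : x ∈ insert x (e.erase v) := Finset.mem_insert_self _ _
    rw [hTdef]
    refine Finset.mem_biUnion.mpr ⟨(insert x (e.erase v), insert v (g.erase x)), ?_, ?_⟩
    · rw [Finset.mem_product, Finset.mem_filter, Finset.mem_filter]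
      exact ⟨⟨by simp [swapEdges], by simp [huv, hue]⟩, by simp [swapEdges], by simp⟩
    · rw [Finset.mem_image]
      exact ⟨x, hx', hinv⟩

open Classical in
lemma card_regularExtensions_mul_pow_le {n k r m : ℕ} {F : Finset (Finset (Fin n))}
    (hk : 2 ≤ k) (hm : k * (m + F.card + k * r * (k * r)) ≤ r * n) (U : Finset (Fin n))
    (hU : U.Nonempty) :
    (regularExtensions n k r F U).card * m ^ (U.card - 1) ≤
      ((regularHypergraphs n k r).filter (fun E => F ⊆ E)).card * (r * r * k) ^ (U.card - 1) := by
  induction hU using Finset.Nonempty.cons_induction with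
  | singleton a =>
    simp only [Finset.card_singleton, Nat.sub_self, pow_zero, mul_one]
    refine Finset.card_le_card fun E hE => ?_
    obtain ⟨hE, hF, -⟩ := mem_regularExtensions.mp hE
    exact Finset.mem_filter.mpr ⟨mem_regularHypergraphs.mpr hE, hF⟩
  | cons a s ha hs ih =>
    rw [Finset.cons_eq_insert, Finset.card_insert_of_notMem ha, Nat.add_sub_cancel]
    obtain ⟨c, hc⟩ : ∃ c, s.card = c + 1 := Nat.exists_eq_succ_of_ne_zero hs.card_pos.ne'
    rw [hc, Nat.add_sub_cancel] at ih
    rw [hc]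
    calc (regularExtensions n k r F (insert a s)).card * m ^ (c + 1)
        = (regularExtensions n k r F (insert a s)).card * m * m ^ c := by ring
      _ ≤ (regularExtensions n k r F s).card * (r * r * k) * m ^ c :=
          Nat.mul_le_mul_right _ (card_regularExtensions_insert_mul_le hk hs ha hm)
      _ = (regularExtensions n k r F s).card * m ^ c * (r * r * k) := by ring
      _ ≤ _ := Nat.mul_le_mul_right _ ih
      _ = _ := by ring

open Classical in
/-- A fixed set `F` of edges is contained in a `(rrk / m) ^ ((k - 1) |F|)` proportion of the
`r`-regular `k`-uniform hypergraphs. -/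
lemma card_filter_subset_mul_pow_le {n k r m : ℕ} (hk : 2 ≤ k) (F : Finset (Finset (Fin n)))
    (hF : ∀ f ∈ F, f.card = k) (hm : k * (m + F.card + k * r * (k * r)) ≤ r * n) :
    ((regularHypergraphs n k r).filter (fun E => F ⊆ E)).card * m ^ ((k - 1) * F.card) ≤
      (regularHypergraphs n k r).card * (r * r * k) ^ ((k - 1) * F.card) := by
  induction F using Finset.induction_on with
  | empty => simp
  | insert f F hf ih =>
    have hfk := hF f (Finset.mem_insert_self _ _)
    rw [Finset.card_insert_of_notMem hf] at hm ⊢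
    have hm' : k * (m + F.card + k * r * (k * r)) ≤ r * n :=
      le_trans (Nat.mul_le_mul_left _ (by omega)) hm
    have ih := ih (fun f' hf' => hF f' (Finset.mem_insert_of_mem hf')) hm'
    have hstep := card_regularExtensions_mul_pow_le (F := F) hk hm' f
      (Finset.card_pos.mp (by omega))
    rw [hfk] at hstep
    have hsub : (regularHypergraphs n k r).filter (fun E => insert f F ⊆ E) ⊆
        regularExtensions n k r F f := by
      intro E hE
      obtain ⟨hE, hFE⟩ := Finset.mem_filter.mp hE
      rw [Finset.insert_subset_iff] at hFE
      exact mem_regularExtensions.mpr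
        ⟨mem_regularHypergraphs.mp hE, hFE.2, f, hFE.1, hf, subset_rfl⟩
    set c := r * r * k
    calc ((regularHypergraphs n k r).filter (fun E => insert f F ⊆ E)).card
          * m ^ ((k - 1) * (F.card + 1))
        ≤ (regularExtensions n k r F f).card * m ^ ((k - 1) * (F.card + 1)) :=
          Nat.mul_le_mul_right _ (Finset.card_le_card hsub)
      _ = (regularExtensions n k r F f).card * m ^ (k - 1) * m ^ ((k - 1) * F.card) := by
          rw [mul_add, pow_add]; ring
      _ ≤ ((regularHypergraphs n k r).filter (fun E => F ⊆ E)).card * c ^ (k - 1)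
          * m ^ ((k - 1) * F.card) := Nat.mul_le_mul_right _ hstep
      _ = ((regularHypergraphs n k r).filter (fun E => F ⊆ E)).card * m ^ ((k - 1) * F.card)
          * c ^ (k - 1) := by ring
      _ ≤ (regularHypergraphs n k r).card * c ^ ((k - 1) * F.card) * c ^ (k - 1) :=
          Nat.mul_le_mul_right _ ih
      _ = _ := by rw [mul_add, pow_add]; ring

open Classical in
lemma card_filter_subset_le {n k r : ℕ} (hk : 2 ≤ k) (hr : 2 ≤ r) (hn : 0 < n)
    (F : Finset (Finset (Fin n))) (hF : ∀ f ∈ F, f.card = k)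
    (hm : k * (1 + F.card + k * r * (k * r)) ≤ n) :
    (((regularHypergraphs n k r).filter (fun E => F ⊆ E)).card : ℝ) ≤
      (regularHypergraphs n k r).card * ((2 * k * (r * r * k) : ℕ) / n : ℝ) ^ ((k - 1) * F.card) := by
  set m := n / (2 * k) + 1 with hmdef
  have hle : k * (m + F.card + k * r * (k * r)) ≤ r * n := by
    have h1 : n / (2 * k) * (2 * k) ≤ n := Nat.div_mul_le_self _ _
    have h2 : 2 * n ≤ r * n := Nat.mul_le_mul_right _ hr
    rw [hmdef]
    nlinarith
  have h := card_filter_subset_mul_pow_le hk F hF hle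
  set N := ((regularHypergraphs n k r).filter (fun E => F ⊆ E)).card
  set M := (regularHypergraphs n k r).card
  set t := (k - 1) * F.card
  have hnR : (0 : ℝ) < n := by exact_mod_cast hn
  have hmR : (0 : ℝ) < m := by positivity
  have hnm : (n : ℝ) ≤ 2 * k * m := by
    have := Nat.lt_mul_div_succ n (by omega : 0 < 2 * k)
    exact_mod_cast this.le
  have h' : (N : ℝ) * (m : ℝ) ^ t ≤ M * ((r * r * k : ℕ) : ℝ) ^ t := by exact_mod_cast h
  have h2 : (N : ℝ) ≤ M * (((r * r * k : ℕ) : ℝ) / m) ^ t := by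
    rw [div_pow, ← mul_div_assoc, le_div_iff₀ (by positivity)]
    exact h'
  refine h2.trans ?_
  gcongr ?_ * ?_ ^ _
  rw [div_le_div_iff₀ hmR hnR]
  push_cast
  have : (0 : ℝ) ≤ r * r * k := by positivity
  nlinarith

open Classical in
lemma card_filter_dense_le {n k r L : ℕ} (hk : 2 ≤ k) (hr : 2 ≤ r) (hn : 0 < n)
    (hm : k * (1 + L ^ k + k * r * (k * r)) ≤ n) (hD : 2 * k * (r * r * k) ≤ n) :
    (((regularHypergraphs n k r).filter (fun E => ¬ ∀ S : Finset (Fin n), S.card ≤ L →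
        (k - 1) * (E.filter (fun e => e ⊆ S)).card ≤ S.card)).card : ℝ) ≤
      (regularHypergraphs n k r).card *
        ((4 * (2 * k * (r * r * k)) : ℕ) ^ ((L + 1) ^ k) / n : ℝ) := by
  set D := 2 * k * (r * r * k) with hDdef
  set M := (regularHypergraphs n k r).card with hM
  have hnR : (0 : ℝ) < n := by exact_mod_cast hn
  have hD1 : 1 ≤ D := by
    rw [hDdef]
    exact Nat.succ_le_of_lt (by positivity)
  have hq1 : (D : ℝ) / n ≤ 1 := by
    rw [div_le_one hnR]
    exact_mod_cast hD
  let 𝓕 : Finset (Fin n) → Finset (Finset (Finset (Fin n))) := fun S =>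
    (S.powersetCard k).powerset.filter (fun F => S.card + 1 ≤ (k - 1) * F.card)
  let 𝓑 : Finset (Finset (Finset (Fin n))) := (Finset.range (L + 1)).biUnion fun s =>
    ((Finset.univ : Finset (Fin n)).powersetCard s).biUnion fun S =>
      (𝓕 S).biUnion fun F => (regularHypergraphs n k r).filter (fun E => F ⊆ E)
  have hsub : (regularHypergraphs n k r).filter (fun E => ¬ ∀ S : Finset (Fin n), S.card ≤ L →
      (k - 1) * (E.filter (fun e => e ⊆ S)).card ≤ S.card) ⊆ 𝓑 := by
    intro E hE
    obtain ⟨hE, hS⟩ := Finset.mem_filter.mp hE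
    push Not at hS
    obtain ⟨S, hSL, hS⟩ := hS
    refine Finset.mem_biUnion.mpr ⟨S.card, Finset.mem_range.mpr (by omega),
      Finset.mem_biUnion.mpr ⟨S, Finset.mem_powersetCard.mpr ⟨Finset.subset_univ _, rfl⟩,
      Finset.mem_biUnion.mpr ⟨E.filter (fun e => e ⊆ S), Finset.mem_filter.mpr ⟨?_, hS⟩,
      Finset.mem_filter.mpr ⟨hE, Finset.filter_subset _ _⟩⟩⟩⟩
    rw [Finset.mem_powerset]
    intro e he
    obtain ⟨he, heS⟩ := Finset.mem_filter.mp he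
    exact Finset.mem_powersetCard.mpr ⟨heS, (mem_regularHypergraphs.mp hE).1 e he⟩
  have hpow : ∀ s, s ≤ L → ∀ S ∈ (Finset.univ : Finset (Fin n)).powersetCard s,
      (S.powersetCard k).card ≤ L ^ k := by
    intro s hs S hS
    rw [Finset.card_powersetCard, (Finset.mem_powersetCard.mp hS).2]
    exact (Nat.choose_le_pow _ _).trans (Nat.pow_le_pow_left hs k)
  have hFbound : ∀ s, s ≤ L → ∀ S ∈ (Finset.univ : Finset (Fin n)).powersetCard s, ∀ F ∈ 𝓕 S,
      (((regularHypergraphs n k r).filter (fun E => F ⊆ E)).card : ℝ) ≤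
        M * ((D : ℝ) / n) ^ (s + 1) := by
    intro s hs S hS F hF
    obtain ⟨hFS, hFc⟩ := Finset.mem_filter.mp hF
    rw [Finset.mem_powerset] at hFS
    have hFL := (Finset.card_le_card hFS).trans (hpow s hs S hS)
    refine (card_filter_subset_le hk hr hn F
      (fun f hf => (Finset.mem_powersetCard.mp (hFS hf)).2) (le_trans ?_ hm)).trans ?_
    · gcongr
    · rw [(Finset.mem_powersetCard.mp hS).2] at hFc
      exact mul_le_mul_of_nonneg_left
        (pow_le_pow_of_le_one (by positivity) hq1 hFc) (by positivity)
  have hSbound : ∀ s, s ≤ L → ∀ S ∈ (Finset.univ : Finset (Fin n)).powersetCard s,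
      (((𝓕 S).biUnion fun F => (regularHypergraphs n k r).filter (fun E => F ⊆ E)).card : ℝ) ≤
        2 ^ L ^ k * (M * ((D : ℝ) / n) ^ (s + 1)) := by
    intro s hs S hS
    have h1 : ((𝓕 S).card : ℝ) ≤ 2 ^ L ^ k := by
      have : (𝓕 S).card ≤ 2 ^ L ^ k := by
        refine (Finset.card_filter_le _ _).trans ?_
        rw [Finset.card_powerset]
        exact Nat.pow_le_pow_right (by norm_num) (hpow s hs S hS)
      exact_mod_cast this
    calc (((𝓕 S).biUnion fun F => (regularHypergraphs n k r).filter (fun E => F ⊆ E)).card : ℝ)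
        ≤ ∑ F ∈ 𝓕 S, (((regularHypergraphs n k r).filter (fun E => F ⊆ E)).card : ℝ) := by
          exact_mod_cast Finset.card_biUnion_le
      _ ≤ (𝓕 S).card • (M * ((D : ℝ) / n) ^ (s + 1)) :=
          Finset.sum_le_card_nsmul _ _ _ (hFbound s hs S hS)
      _ ≤ _ := by
          rw [nsmul_eq_mul]
          gcongr
  have hsbound : ∀ s ∈ Finset.range (L + 1),
      ((((Finset.univ : Finset (Fin n)).powersetCard s).biUnion fun S =>
        (𝓕 S).biUnion fun F => (regularHypergraphs n k r).filter (fun E => F ⊆ E)).card : ℝ) ≤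
        2 ^ L ^ k * (M * ((D : ℝ) ^ (L + 1) / n)) := by
    intro s hs
    have hsL : s ≤ L := by
      rw [Finset.mem_range] at hs
      omega
    have h1 : (((Finset.univ : Finset (Fin n)).powersetCard s).card : ℝ) ≤ (n : ℝ) ^ s := by
      have : ((Finset.univ : Finset (Fin n)).powersetCard s).card ≤ n ^ s := by
        rw [Finset.card_powersetCard, Finset.card_univ, Fintype.card_fin]
        exact Nat.choose_le_pow _ _
      exact_mod_cast this
    calc ((((Finset.univ : Finset (Fin n)).powersetCard s).biUnion fun S =>
          (𝓕 S).biUnion fun F => (regularHypergraphs n k r).filter (fun E => F ⊆ E)).card : ℝ)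
        ≤ ∑ S ∈ (Finset.univ : Finset (Fin n)).powersetCard s, (((𝓕 S).biUnion fun F =>
            (regularHypergraphs n k r).filter (fun E => F ⊆ E)).card : ℝ) := by
          exact_mod_cast Finset.card_biUnion_le
      _ ≤ ((Finset.univ : Finset (Fin n)).powersetCard s).card •
            (2 ^ L ^ k * (M * ((D : ℝ) / n) ^ (s + 1))) :=
          Finset.sum_le_card_nsmul _ _ _ (hSbound s hsL)
      _ ≤ (n : ℝ) ^ s * (2 ^ L ^ k * (M * ((D : ℝ) / n) ^ (s + 1))) := by
          rw [nsmul_eq_mul]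
          gcongr
      _ = 2 ^ L ^ k * (M * ((D : ℝ) ^ (s + 1) / n)) := by
          rw [div_pow, pow_succ (n : ℝ) s]
          field_simp
      _ ≤ _ := by
          have : (1 : ℝ) ≤ D := by exact_mod_cast hD1
          gcongr
  have hB : (L + 1) ≤ (L + 1) ^ k := Nat.le_self_pow (by omega) _
  have hB' : L ^ k ≤ (L + 1) ^ k := Nat.pow_le_pow_left (by omega) _
  have hnum : (L + 1) * (2 ^ L ^ k * D ^ (L + 1)) ≤ (4 * D) ^ ((L + 1) ^ k) := by
    calc (L + 1) * (2 ^ L ^ k * D ^ (L + 1))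
        ≤ 2 ^ ((L + 1) ^ k) * (2 ^ ((L + 1) ^ k) * D ^ ((L + 1) ^ k)) := by
          refine Nat.mul_le_mul (hB.trans Nat.lt_two_pow_self.le) (Nat.mul_le_mul ?_ ?_)
          · exact Nat.pow_le_pow_right (by norm_num) hB'
          · exact Nat.pow_le_pow_right hD1 hB
      _ = _ := by
          rw [← mul_assoc, ← mul_pow, ← mul_pow]
          norm_num
  calc _ ≤ (𝓑.card : ℝ) := by exact_mod_cast Finset.card_le_card hsub
    _ ≤ ∑ s ∈ Finset.range (L + 1), ((((Finset.univ : Finset (Fin n)).powersetCard s).biUnion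
          fun S => (𝓕 S).biUnion fun F =>
            (regularHypergraphs n k r).filter (fun E => F ⊆ E)).card : ℝ) := by
        exact_mod_cast Finset.card_biUnion_le
    _ ≤ (Finset.range (L + 1)).card • (2 ^ L ^ k * (M * ((D : ℝ) ^ (L + 1) / n))) :=
        Finset.sum_le_card_nsmul _ _ _ hsbound
    _ = M * ((((L + 1) * (2 ^ L ^ k * D ^ (L + 1)) : ℕ) : ℝ) / n) := by
        rw [Finset.card_range, nsmul_eq_mul]
        push_cast
        ring
    _ ≤ _ := by
        gcongr
        exact_mod_cast hnum

/-- A bounded multiple of `log log n`, raised to a fixed power, is `o(log n)`. -/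
lemma isLittleO_ceil_log_log_pow (a : ℝ) (k : ℕ) :
    (fun n : ℕ => (((2 * ⌈100 * Real.log (Real.log n) / a⌉₊ + 1) ^ k : ℕ) : ℝ))
      =o[atTop] (fun n : ℕ => Real.log n) := by
  have hlog : Tendsto (fun n : ℕ => Real.log n) atTop atTop :=
    Real.tendsto_log_atTop.comp tendsto_natCast_atTop_atTop
  have h1 : (fun n : ℕ => Real.log (Real.log n) ^ k) =o[atTop] (fun n : ℕ => Real.log n) :=
    (Real.isLittleO_pow_log_id_atTop (n := k)).comp_tendsto hlog
  refine Asymptotics.IsBigO.trans_isLittleO ?_ h1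
  push_cast
  refine Asymptotics.IsBigO.pow ?_ k
  have h2 : ∀ᶠ n : ℕ in atTop, 1 ≤ Real.log (Real.log n) :=
    (Real.tendsto_log_atTop.comp hlog).eventually_ge_atTop 1
  refine Asymptotics.IsBigO.of_bound (200 / |a| + 3) ?_
  filter_upwards [h2] with n hn
  set y := Real.log (Real.log n)
  rw [Real.norm_of_nonneg (by positivity), Real.norm_of_nonneg (by linarith)]
  have h3 : (⌈100 * y / a⌉₊ : ℝ) ≤ 100 * y / |a| + 1 := by
    refine (Nat.cast_le.mpr (Nat.ceil_mono ?_)).trans (Nat.ceil_lt_add_one (by positivity)).le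
    refine (le_abs_self _).trans_eq ?_
    rw [abs_div, abs_of_nonneg (by positivity)]
  calc 2 * (⌈100 * y / a⌉₊ : ℝ) + 1 ≤ 2 * (100 * y / |a| + 1) + 1 := by gcongr
    _ = 200 / |a| * y + 3 := by ring
    _ ≤ _ := by linarith

lemma one_sub_card_filter_not_div_le_regularProb {n k r : ℕ}
    (hne : (regularHypergraphs n k r).Nonempty) (P : Finset (Finset (Fin n)) → Prop)
    [DecidablePred fun E => ¬ P E] {b : ℝ}
    (h : (((regularHypergraphs n k r).filter (fun E => ¬ P E)).card : ℝ) ≤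
      (regularHypergraphs n k r).card * b) :
    1 - b ≤ regularProb n k r P := by
  classical
  have hpos : (0 : ℝ) < (regularHypergraphs n k r).card := by exact_mod_cast hne.card_pos
  have hadd : (((regularHypergraphs n k r).filter P).card : ℝ) +
      ((regularHypergraphs n k r).filter (fun E => ¬ P E)).card =
      (regularHypergraphs n k r).card := by
    exact_mod_cast Finset.card_filter_add_card_filter_not P
  unfold regularProb
  rw [le_div_iff₀ hpos]
  have h' : (((regularHypergraphs n k r).filter (fun E => ¬ P E)).card : ℝ) ≤
      (regularHypergraphs n k r).card * b := by convert h
  have h'' : (((regularHypergraphs n k r).filter P).card : ℝ) ≥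
      (1 - b) * (regularHypergraphs n k r).card := by linarith
  convert h''

lemma regularProb_le_one {n k r : ℕ} (P : Finset (Finset (Fin n)) → Prop) :
    regularProb n k r P ≤ 1 := by
  classical
  unfold regularProb
  refine div_le_one_of_le₀ ?_ (by positivity)
  exact_mod_cast Finset.card_filter_le _ _

lemma tendsto_pow_div_zero_of_isLittleO_log {f : ℕ → ℕ} {C : ℕ} (hC : 0 < C)
    (hf : (fun n : ℕ => (f n : ℝ)) =o[atTop] (fun n : ℕ => Real.log n)) :
    Tendsto (fun n : ℕ => (C : ℝ) ^ f n / n) atTop (nhds 0) := by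
  have hlog : Tendsto (fun n : ℕ => Real.log n) atTop atTop :=
    Real.tendsto_log_atTop.comp tendsto_natCast_atTop_atTop
  have hhalf : ∀ᶠ n : ℕ in atTop, Real.log C * f n ≤ 1 / 2 * Real.log n := by
    filter_upwards [(hf.const_mul_left (Real.log C)).bound
      (by norm_num : (0 : ℝ) < 1 / 2), hlog.eventually_ge_atTop 0] with n hn hn0
    rw [Real.norm_of_nonneg hn0] at hn
    exact (le_abs_self _).trans hn
  have hexp : Tendsto (fun n : ℕ => Real.exp (-(1 / 2 * Real.log n))) atTop (nhds 0) :=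
    Real.tendsto_exp_neg_atTop_nhds_zero.comp (hlog.const_mul_atTop (by norm_num))
  refine squeeze_zero' (Eventually.of_forall fun n => by positivity) ?_ hexp
  filter_upwards [hhalf, eventually_gt_atTop 0] with n hn hn0
  have hnR : (0 : ℝ) < n := by exact_mod_cast hn0
  have hCR : (0 : ℝ) < C := by exact_mod_cast hC
  calc (C : ℝ) ^ f n / n = Real.exp (Real.log C * f n - Real.log n) := by
        rw [Real.exp_sub, Real.exp_log hnR, mul_comm (Real.log _), Real.exp_nat_mul,
          Real.exp_log hCR]
    _ ≤ _ := Real.exp_le_exp.mpr (by linarith)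

lemma eventually_mul_add_le_of_isLittleO_log {f : ℕ → ℕ} (a b : ℕ)
    (hf : (fun n : ℕ => (f n : ℝ)) =o[atTop] (fun n : ℕ => Real.log n)) :
    ∀ᶠ n : ℕ in atTop, a * f n + b ≤ n := by
  have hlogn : (fun n : ℕ => Real.log n) =o[atTop] (fun n : ℕ => (n : ℝ)) :=
    Real.isLittleO_log_id_atTop.comp_tendsto tendsto_natCast_atTop_atTop
  have h1 := ((hf.trans hlogn).const_mul_left (a : ℝ)).bound (by norm_num : (0 : ℝ) < 1 / 2)
  filter_upwards [h1, eventually_ge_atTop (2 * b)] with n hn hn'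
  rw [Real.norm_of_nonneg (by positivity), Real.norm_of_nonneg (by positivity)] at hn
  have h2 : (a : ℝ) * f n * 2 ≤ n := by linarith
  have h3 : a * f n * 2 ≤ n := by exact_mod_cast h2
  omega

/-- If `(L n + 1) ^ k = o(log n)`, then w.h.p. every vertex set `S` of size at most `L n` spans at
most `|S| / (k - 1)` edges. -/
lemma tendsto_regularProb_sparse {r k : ℕ} (hr : 2 ≤ r) (hk : 2 ≤ k) {L : ℕ → ℕ}
    (hL : (fun n : ℕ => (((L n + 1) ^ k : ℕ) : ℝ)) =o[atTop] (fun n : ℕ => Real.log n)) :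
    Tendsto (fun n : ℕ => regularProb n k r (fun E => ∀ S : Finset (Fin n), S.card ≤ L n →
      (k - 1) * (E.filter (fun e => e ⊆ S)).card ≤ S.card)) (regularFilter k r) (nhds 1) := by
  have hbound := tendsto_pow_div_zero_of_isLittleO_log
    (C := 4 * (2 * k * (r * r * k))) (by positivity) hL
  have hlower := (tendsto_const_nhds (x := (1 : ℝ))).sub
    (hbound.mono_left (inf_le_left : regularFilter k r ≤ atTop))
  rw [sub_zero] at hlower
  refine tendsto_of_tendsto_of_tendsto_of_le_of_le' hlower tendsto_const_nhds ?_
    (Eventually.of_forall fun n => regularProb_le_one _)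
  have hlarge := (eventually_mul_add_le_of_isLittleO_log k (k * (1 + k * r * (k * r))) hL).and
    ((eventually_ge_atTop (2 * k * (r * r * k))).and (eventually_gt_atTop 0))
  have hne : ∀ᶠ n : ℕ in regularFilter k r, k ∣ r * n ∧ (regularHypergraphs n k r).Nonempty :=
    (eventually_principal.mpr fun n hn => hn).filter_mono inf_le_right
  filter_upwards [hlarge.filter_mono inf_le_left, hne] with n hn hn'
  obtain ⟨hn1, hn2, hn3⟩ := hn
  refine one_sub_card_filter_not_div_le_regularProb hn'.2 _
    (card_filter_dense_le hk hr hn3 (le_trans ?_ hn1) hn2)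
  have : k * L n ^ k ≤ k * (L n + 1) ^ k :=
    Nat.mul_le_mul_left _ (Nat.pow_le_pow_left (by omega) _)
  linarith

/-- W.h.p. (along `n` with `k ∣ rn`), every vertex set `S` of size at most
`2ℓ₀ = 2⌈100 log_ρ log n⌉` in the random `r`-regular `k`-uniform hypergraph spans at
most `|S|/(k-1)` edges, i.e. `(k-1)·e_H(S) ≤ |S|`. -/
theorem regular_sparse_small_sets_whp (r k : ℕ) (hr : 2 ≤ r) (hk : 3 ≤ k) :
    Tendsto (fun n : ℕ => regularProb n k r (fun E =>
        ∀ S : Finset (Fin n),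
          S.card ≤ 2 * ⌈(100 : ℝ) * Real.log (Real.log n) /
              Real.log (((r - 1) * (k - 1) : ℕ) : ℝ)⌉₊ →
          (k - 1) * (E.filter (fun e => e ⊆ S)).card ≤ S.card))
      (regularFilter k r) (nhds 1) := by
  exact tendsto_regularProb_sparse hr (by omega) (isLittleO_ceil_log_log_pow _ k)
end

section
/- Fix an integer r ≥ 2. There exists a constant c₀ > 0 such that for all μ and all integers s with μ^{5/9} < s < μ^{3/5}: if R is a set of size rμ partitioned into μ parts R_1,...,R_μ each of size r, and S is a uniformly random s-element subset of R, then for every integer j, the probability that the number of parts intersected by S equals j is at most c₀·μ^{1/2}/s. -/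
/-- We model a set `R` of size `rμ` partitioned into `μ` parts of size `r` as
`Fin μ × Fin r`, with parts `R_i = {i} × Fin r`. `sSubsets r μ s` is the set of all
`s`-element subsets of `R`; a uniformly random `s`-subset is a uniform element of it. -/
def sSubsets (r μ s : ℕ) : Finset (Finset (Fin μ × Fin r)) :=
  Finset.powersetCard s (Finset.univ : Finset (Fin μ × Fin r))

/-- `X_S`, the number of parts `R_i` intersected by `S`. -/
def numPartsHit {μ r : ℕ} (S : Finset (Fin μ × Fin r)) : ℕ :=
  (S.image Prod.fst).card

/-- The probability, for a uniformly random `s`-element subset `S` of `R`,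
of the event `P S`. -/
noncomputable def subsetProb (r μ s : ℕ) (P : Finset (Fin μ × Fin r) → Prop)
    [DecidablePred P] : ℝ :=
  (((sSubsets r μ s).filter P).card : ℝ) / ((sSubsets r μ s).card : ℝ)

/-- `P_j`: the probability that `X_S = j` and every part meets `S` in at most two
elements. -/
noncomputable def Pj (r μ s j : ℕ) : ℝ :=
  subsetProb r μ s (fun S => numPartsHit S = j ∧
    ∀ i : Fin μ, (S.filter (fun x => x.1 = i)).card ≤ 2)


section Counting

open Finset

/-- The number of elements of `S` in the part `i`. -/
def fiberCard {μ r : ℕ} (S : Finset (Fin μ × Fin r)) (i : Fin μ) : ℕ :=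
  (S.filter (fun x => x.1 = i)).card

/-- The number of parts meeting `S` in exactly `m` elements. -/
def numMult {μ r : ℕ} (m : ℕ) (S : Finset (Fin μ × Fin r)) : ℕ :=
  (univ.filter (fun i => fiberCard S i = m)).card

/-- The sets meeting exactly `a` parts in one element, exactly `b` parts in two elements,
and no part in more than two elements. -/
def singleDouble (r μ a b : ℕ) : Finset (Finset (Fin μ × Fin r)) :=
  univ.filter (fun S => numMult 1 S = a ∧ numMult 2 S = b ∧ ∀ i, fiberCard S i ≤ 2)

variable {μ r : ℕ}

theorem fiberCard_insert {U : Finset (Fin μ × Fin r)} {y : Fin μ × Fin r} (hy : y ∉ U)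
    (i : Fin μ) :
    fiberCard (insert y U) i = if i = y.1 then fiberCard U i + 1 else fiberCard U i := by
  unfold fiberCard
  rw [filter_insert]
  by_cases h : i = y.1
  · subst h
    simp [hy]
  · simp [h, Ne.symm h]

theorem card_mem_fiber (S : Finset (Fin μ × Fin r)) (m : ℕ) :
    (S.filter (fun y => fiberCard S y.1 = m)).card = numMult m S * m := by
  have := card_eq_sum_card_fiberwise (s := S.filter (fun y => fiberCard S y.1 = m))
    (t := univ.filter (fun i => fiberCard S i = m)) (f := Prod.fst) (by
      intro y hy
      simpa using (mem_filter.1 hy).2)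
  rw [this, numMult, ← smul_eq_mul, ← sum_const]
  refine sum_congr rfl fun i hi => ?_
  have hi' := (mem_filter.1 hi).2
  conv_rhs => rw [← hi']
  unfold fiberCard
  congr 1
  ext y
  simp only [mem_filter]
  constructor
  · rintro ⟨⟨h1, _⟩, h3⟩
    exact ⟨h1, h3⟩
  · rintro ⟨h1, h3⟩
    exact ⟨⟨h1, by rw [h3]; exact hi'⟩, h3⟩

theorem card_part (i : Fin μ) :
    (univ.filter (fun y : Fin μ × Fin r => y.1 = i)).card = r := by
  have : (univ.filter (fun y : Fin μ × Fin r => y.1 = i)) = {i} ×ˢ univ := by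
    ext y
    simp only [mem_filter, mem_univ, true_and, mem_product, mem_singleton, and_true]
  rw [this, card_product, card_singleton, one_mul, card_univ, Fintype.card_fin]

theorem card_notMem_fiber (S : Finset (Fin μ × Fin r)) (m : ℕ) :
    (univ.filter (fun y => y ∉ S ∧ fiberCard S y.1 = m)).card = numMult m S * (r - m) := by
  have := card_eq_sum_card_fiberwise
    (s := univ.filter (fun y : Fin μ × Fin r => y ∉ S ∧ fiberCard S y.1 = m))
    (t := univ.filter (fun i => fiberCard S i = m)) (f := Prod.fst) (by
      intro y hy
      simpa using (mem_filter.1 hy).2.2)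
  rw [this, numMult, ← smul_eq_mul, ← sum_const]
  refine sum_congr rfl fun i hi => ?_
  have hi' := (mem_filter.1 hi).2
  have h2 : filter (fun y => y.1 = i)
      (univ.filter (fun y : Fin μ × Fin r => y ∉ S ∧ fiberCard S y.1 = m))
      = univ.filter (fun y : Fin μ × Fin r => y.1 = i) \ S.filter (fun y => y.1 = i) := by
    ext y
    simp only [mem_filter, mem_sdiff, mem_univ, true_and, not_and]
    constructor
    · rintro ⟨⟨h1, _⟩, h3⟩
      exact ⟨h3, fun h => absurd h h1⟩
    · rintro ⟨h3, h1⟩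
      exact ⟨⟨fun h => h1 h h3, by rw [h3]; exact hi'⟩, h3⟩
  rw [h2, card_sdiff_of_subset (filter_subset_filter _ (subset_univ S)), card_part]
  conv_rhs => rw [← hi']
  rfl

theorem sum_fiberCard (S : Finset (Fin μ × Fin r)) : ∑ i, fiberCard S i = S.card :=
  (card_eq_sum_card_fiberwise (f := Prod.fst) (fun _ _ => mem_univ _)).symm

/-- Double counting of the pairs consisting of a set and an element added to it. -/
theorem sum_card_insert (𝒜 ℬ : Finset (Finset (Fin μ × Fin r))) (m : ℕ)
    (h : ∀ U y, y ∉ U → fiberCard U y.1 = m → (U ∈ 𝒜 ↔ insert y U ∈ ℬ)) :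
    ∑ U ∈ 𝒜, numMult m U * (r - m) = ∑ S ∈ ℬ, numMult (m + 1) S * (m + 1) := by
  simp_rw [← card_notMem_fiber, ← card_mem_fiber]
  rw [← card_sigma, ← card_sigma]
  refine card_nbij' (fun p => ⟨insert p.2 p.1, p.2⟩) (fun p => ⟨p.1.erase p.2, p.2⟩)
    ?_ ?_ ?_ ?_
  · rintro ⟨U, y⟩ hp
    simp only [coe_sigma, Set.mem_sigma_iff, mem_coe, mem_filter, mem_univ, true_and] at hp ⊢
    obtain ⟨hU, hy, hm⟩ := hp
    refine ⟨(h U y hy hm).1 hU, mem_insert_self _ _, ?_⟩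
    rw [fiberCard_insert hy, if_pos rfl, hm]
  · rintro ⟨S, y⟩ hp
    simp only [coe_sigma, Set.mem_sigma_iff, mem_coe, mem_filter, mem_univ, true_and] at hp ⊢
    obtain ⟨hS, hy, hm⟩ := hp
    have hn := notMem_erase y S
    have he := insert_erase hy
    have hm' : fiberCard (S.erase y) y.1 = m := by
      have := fiberCard_insert hn y.1
      rw [he, if_pos rfl] at this
      omega
    refine ⟨(h _ y hn hm').2 (by rwa [he]), hn, hm'⟩
  · rintro ⟨U, y⟩ hp
    simp only [coe_sigma, Set.mem_sigma_iff, mem_coe, mem_filter, mem_univ, true_and] at hp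
    simp [erase_insert hp.2.1]
  · rintro ⟨S, y⟩ hp
    simp only [coe_sigma, Set.mem_sigma_iff, mem_coe, mem_filter] at hp
    simp [insert_erase hp.2.1]

theorem numMult_insert_succ {U : Finset (Fin μ × Fin r)} {y : Fin μ × Fin r} (hy : y ∉ U) :
    numMult (fiberCard U y.1 + 1) (insert y U) = numMult (fiberCard U y.1 + 1) U + 1 := by
  unfold numMult
  rw [← card_insert_of_notMem (a := y.1) (by simp)]
  congr 1
  ext i
  simp only [mem_filter, mem_univ, true_and, mem_insert, fiberCard_insert hy]
  by_cases h : i = y.1 <;> simp [h]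

theorem numMult_insert_self {U : Finset (Fin μ × Fin r)} {y : Fin μ × Fin r} (hy : y ∉ U) :
    numMult (fiberCard U y.1) (insert y U) + 1 = numMult (fiberCard U y.1) U := by
  unfold numMult
  rw [← card_insert_of_notMem (a := y.1) (by simp [fiberCard_insert hy])]
  congr 1
  ext i
  simp only [mem_filter, mem_univ, true_and, mem_insert, fiberCard_insert hy]
  by_cases h : i = y.1 <;> simp [h]

theorem numMult_insert_of_ne {U : Finset (Fin μ × Fin r)} {y : Fin μ × Fin r} (hy : y ∉ U)
    {m : ℕ} (h0 : m ≠ fiberCard U y.1) (h1 : m ≠ fiberCard U y.1 + 1) :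
    numMult m (insert y U) = numMult m U := by
  unfold numMult
  congr 1
  ext i
  simp only [mem_filter, mem_univ, true_and, fiberCard_insert hy]
  by_cases h : i = y.1
  · subst h
    simp [Ne.symm h0, Ne.symm h1]
  · simp [h]

theorem fiberCard_insert_le_two_iff {U : Finset (Fin μ × Fin r)} {y : Fin μ × Fin r}
    (hy : y ∉ U) (hm : fiberCard U y.1 ≤ 1) :
    (∀ i, fiberCard (insert y U) i ≤ 2) ↔ ∀ i, fiberCard U i ≤ 2 := by
  refine forall_congr' fun i => ?_
  rw [fiberCard_insert hy]
  by_cases h : i = y.1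
  · subst h
    simp
    omega
  · simp [h]

theorem numMult_add_of_le_two {S : Finset (Fin μ × Fin r)} (h : ∀ i, fiberCard S i ≤ 2) :
    numMult 0 S + numMult 1 S + numMult 2 S = μ := by
  have h1 : ∀ m, numMult m S = ∑ i, if fiberCard S i = m then 1 else 0 := fun m => by
    rw [numMult, card_filter]
  rw [h1, h1, h1, ← sum_add_distrib, ← sum_add_distrib]
  conv_rhs => rw [← Fintype.card_fin μ, ← card_univ, card_eq_sum_ones]
  refine sum_congr rfl fun i _ => ?_
  have := h i
  interval_cases fiberCard S i <;> simp

theorem card_eq_of_le_two {S : Finset (Fin μ × Fin r)} (h : ∀ i, fiberCard S i ≤ 2) :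
    S.card = numMult 1 S + 2 * numMult 2 S := by
  have h1 : ∀ m, numMult m S = ∑ i, if fiberCard S i = m then 1 else 0 := fun m => by
    rw [numMult, card_filter]
  rw [h1, h1, mul_sum, ← sum_add_distrib, ← sum_fiberCard]
  refine sum_congr rfl fun i _ => ?_
  have := h i
  interval_cases fiberCard S i <;> simp

theorem numPartsHit_add_numMult_zero (S : Finset (Fin μ × Fin r)) :
    numPartsHit S + numMult 0 S = μ := by
  have h : S.image Prod.fst = univ.filter (fun i => ¬ fiberCard S i = 0) := by
    ext i
    simp only [mem_image, mem_filter, mem_univ, true_and, fiberCard, card_eq_zero,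
      filter_eq_empty_iff, not_forall, not_not, exists_prop]
  rw [numPartsHit, numMult, h, add_comm, card_filter_add_card_filter_not, card_univ,
    Fintype.card_fin]

theorem singleDouble_add_single (r μ a b : ℕ) :
    (singleDouble r μ a b).card * ((μ - (a + b)) * r)
      = (singleDouble r μ (a + 1) b).card * (a + 1) := by
  have := sum_card_insert (singleDouble r μ a b) (singleDouble r μ (a + 1) b) 0 (by
    intro U y hy hm
    have e1 := numMult_insert_succ hy
    have e2 := numMult_insert_of_ne hy (m := 2) (by omega) (by omega)
    have e3 := fiberCard_insert_le_two_iff hy (by omega)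
    rw [hm, zero_add] at e1
    simp only [singleDouble, mem_filter, mem_univ, true_and, e1, e2, e3, add_left_inj])
  rw [sum_congr rfl (g := fun _ => (μ - (a + b)) * r), sum_const, smul_eq_mul] at this
  · rw [this, sum_congr rfl (g := fun _ => a + 1), sum_const, smul_eq_mul]
    intro S hS
    rw [(mem_filter.1 hS).2.1]
    ring
  · intro S hS
    obtain ⟨h1, h2, h3⟩ := (mem_filter.1 hS).2
    have := numMult_add_of_le_two h3
    rw [show numMult 0 S = μ - (a + b) by omega, Nat.sub_zero]

theorem singleDouble_single_to_double (r μ a b : ℕ) :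
    (singleDouble r μ (a + 1) b).card * ((a + 1) * (r - 1))
      = (singleDouble r μ a (b + 1)).card * (2 * (b + 1)) := by
  have := sum_card_insert (singleDouble r μ (a + 1) b) (singleDouble r μ a (b + 1)) 1 (by
    intro U y hy hm
    have e1 := numMult_insert_succ hy
    have e2 := numMult_insert_self hy
    have e3 := fiberCard_insert_le_two_iff hy (by omega)
    rw [hm] at e1 e2
    norm_num at e1
    simp only [singleDouble, mem_filter, mem_univ, true_and, e1, e3, ← e2, add_left_inj])
  rw [sum_congr rfl (g := fun _ => (a + 1) * (r - 1)), sum_const, smul_eq_mul] at this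
  · rw [this, sum_congr rfl (g := fun _ => 2 * (b + 1)), sum_const, smul_eq_mul]
    intro S hS
    norm_num
    rw [(mem_filter.1 hS).2.2.1]
    ring
  · intro S hS
    rw [(mem_filter.1 hS).2.1]

theorem singleDouble_ratio (r μ a b : ℕ) :
    (singleDouble r μ (a + 2) b).card * ((a + 2) * (a + 1) * (r - 1))
      = (singleDouble r μ a (b + 1)).card * (2 * (b + 1) * r * (μ - (a + 1 + b))) := by
  have h1 := singleDouble_add_single r μ (a + 1) b
  have h2 := singleDouble_single_to_double r μ a b
  calc _ = (singleDouble r μ (a + 1 + 1) b).card * (a + 1 + 1) * ((a + 1) * (r - 1)) := by ring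
    _ = (singleDouble r μ (a + 1) b).card * ((a + 1) * (r - 1)) * ((μ - (a + 1 + b)) * r) := by
      rw [← h1]; ring
    _ = _ := by rw [h2]; ring

theorem sum_singleDouble_le (r μ s : ℕ) (B : Finset ℕ) (hB : ∀ b ∈ B, 2 * b ≤ s) :
    ∑ b ∈ B, (singleDouble r μ (s - 2 * b) b).card ≤ (sSubsets r μ s).card := by
  rw [← card_biUnion]
  · refine card_le_card fun S hS => ?_
    obtain ⟨b, hb, hS⟩ := mem_biUnion.1 hS
    obtain ⟨h1, h2, h3⟩ := (mem_filter.1 hS).2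
    have := card_eq_of_le_two h3
    have := hB b hb
    exact mem_powersetCard.2 ⟨subset_univ _, by omega⟩
  · intro b _ c _ hbc
    refine disjoint_left.2 fun S hS hS' => hbc ?_
    rw [← (mem_filter.1 hS).2.2.1, ← (mem_filter.1 hS').2.2.1]

/-- The number of `s`-sets with at least three elements in some part. -/
theorem card_three_le_fiberCard (r μ s : ℕ) :
    ((sSubsets r μ s).filter (fun S => ∃ i, 3 ≤ fiberCard S i)).card
      ≤ μ * r ^ 3 * (r * μ).choose (s - 3) := by
  let f : (Fin μ × Fin r × Fin r × Fin r) × Finset (Fin μ × Fin r) → Finset (Fin μ × Fin r) :=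
    fun p => {(p.1.1, p.1.2.1), (p.1.1, p.1.2.2.1), (p.1.1, p.1.2.2.2)} ∪ p.2
  calc _ ≤ ((univ ×ˢ powersetCard (s - 3) univ).image f).card := by
        refine card_le_card fun S hS => ?_
        obtain ⟨hS, i, hi⟩ := mem_filter.1 hS
        have hs := (mem_powersetCard.1 hS).2
        obtain ⟨x, hx, y, hy, z, hz, hxy, hxz, hyz⟩ := two_lt_card.1 (show 2 < _ from hi)
        simp only [mem_filter] at hx hy hz
        have hsub : ({x, y, z} : Finset (Fin μ × Fin r)) ⊆ S := by
          intro w hw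
          simp only [mem_insert, mem_singleton] at hw
          rcases hw with rfl | rfl | rfl
          exacts [hx.1, hy.1, hz.1]
        refine mem_image.2 ⟨((i, x.2, y.2, z.2), S \ {x, y, z}), ?_, ?_⟩
        · refine mem_product.2 ⟨mem_univ _, mem_powersetCard.2 ⟨subset_univ _, ?_⟩⟩
          rw [card_sdiff_of_subset hsub, hs, card_eq_three.2 ⟨x, y, z, hxy, hxz, hyz, rfl⟩]
        · have ex : (i, x.2) = x := Prod.ext hx.2.symm rfl
          have ey : (i, y.2) = y := Prod.ext hy.2.symm rfl
          have ez : (i, z.2) = z := Prod.ext hz.2.symm rfl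
          simp only [f, ex, ey, ez]
          exact union_sdiff_of_subset hsub
    _ ≤ _ := card_image_le
    _ = _ := by
        rw [card_product, card_powersetCard]
        simp only [card_univ, Fintype.card_prod, Fintype.card_fin]
        ring_nf

theorem card_sSubsets (r μ s : ℕ) : (sSubsets r μ s).card = (r * μ).choose s := by
  rw [sSubsets, card_powersetCard]
  simp [mul_comm]

theorem filter_numPartsHit_subset (r μ s j : ℕ) :
    (sSubsets r μ s).filter (fun S => numPartsHit S = j) ⊆
      (sSubsets r μ s).filter (fun S => ∃ i, 3 ≤ fiberCard S i) ∪
        (if j ≤ s ∧ 2 * (s - j) ≤ s then singleDouble r μ (s - 2 * (s - j)) (s - j) else ∅) := by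
  intro S hS
  obtain ⟨hS, hj⟩ := mem_filter.1 hS
  by_cases h : ∃ i, 3 ≤ fiberCard S i
  · exact mem_union_left _ (mem_filter.2 ⟨hS, h⟩)
  · push Not at h
    have h3 : ∀ i, fiberCard S i ≤ 2 := fun i => Nat.le_of_lt_succ (h i)
    have e1 := card_eq_of_le_two h3
    have e2 := numMult_add_of_le_two h3
    have e3 := numPartsHit_add_numMult_zero S
    have e4 := (mem_powersetCard.1 hS).2
    refine mem_union_right _ ?_
    rw [if_pos (by omega)]
    exact mem_filter.2 ⟨mem_univ _, by omega, by omega, h3⟩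

end Counting

section Analysis

/-- A sequence whose consecutive ratios stay above `1 - D / t` loses at most a factor
`1 - D * n / t` in `n` steps. -/
theorem le_of_ratio_ge {u : ℕ → ℝ} {D t : ℝ} (ht : 0 < t) (hD : 0 ≤ D) (hDt : D ≤ t) {n : ℕ}
    (hu : ∀ i < n, (1 - D / t) * u i ≤ u (i + 1)) (h0 : 0 ≤ u 0) :
    ∀ i ≤ n, (1 - D * i / t) * u 0 ≤ u i := by
  intro i hi
  induction i with
  | zero => simp
  | succ i ih =>
    have h1 := ih (by omega)
    have h2 := hu i (by omega)
    have h3 : 0 ≤ 1 - D / t := by rw [sub_nonneg, div_le_one ht]; exact hDt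
    have h4 := mul_le_mul_of_nonneg_left h1 h3
    have h5 : 0 ≤ D / t * (D * i / t) * u 0 := by positivity
    have h6 : (1 - D / t) * ((1 - D * i / t) * u 0)
        = (1 - D * ((i + 1 : ℕ) : ℝ) / t) * u 0 + D / t * (D * i / t) * u 0 := by
      push_cast
      ring
    linarith

theorem up_ratio {κ t q s b : ℝ} (hκ : 1 / 4 ≤ κ) (hκ' : κ ≤ 1 / 2) (ht : 24 ≤ t)
    (hs : s = t * q) (hq : t ^ 2 ≤ q) (hb0 : 0 ≤ b) (hb : b + 1 ≤ κ * t ^ 2 + t) :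
    (1 - 12 / t) * ((b + 1) * (q ^ 2 - s + b + 1)) ≤ κ * ((s - 2 * b) * (s - 2 * b - 1)) := by
  have ht0 : 0 < t := by linarith
  have hK : κ * t ^ 2 + t ≤ t ^ 2 := by nlinarith
  have hq0 : 0 < q := lt_of_lt_of_le (by positivity) hq
  have hsK : 2 * (κ * t ^ 2 + t) ≤ s := by
    rw [hs]
    nlinarith
  have h12 : 0 ≤ 1 - 12 / t := by
    rw [sub_nonneg, div_le_one ht0]
    linarith
  have hlhs : (b + 1) * (q ^ 2 - s + b + 1) ≤ (κ * t ^ 2 + t) * q ^ 2 := by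
    refine (mul_le_mul_of_nonneg_left (c := q ^ 2) (by linarith) (by linarith)).trans ?_
    exact mul_le_mul_of_nonneg_right hb (by positivity)
  have hrhs : s ^ 2 - 4 * (κ * t ^ 2 + t) * s ≤ (s - 2 * b) * (s - 2 * b - 1) := by
    have h1 : (s - 2 * (κ * t ^ 2 + t)) * (s - 2 * (κ * t ^ 2 + t))
        ≤ (s - 2 * b) * (s - 2 * b - 1) :=
      mul_le_mul (by linarith) (by linarith) (by linarith) (by linarith)
    linarith [sq_nonneg (κ * t ^ 2 + t),
      show (s - 2 * (κ * t ^ 2 + t)) * (s - 2 * (κ * t ^ 2 + t))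
        = s ^ 2 - 4 * (κ * t ^ 2 + t) * s + 4 * (κ * t ^ 2 + t) ^ 2 by ring]
  have hKs : (κ * t ^ 2 + t) * s ≤ t * q ^ 2 := by
    rw [hs, show t * q ^ 2 = q * (t * q) by ring]
    exact mul_le_mul_of_nonneg_right (hK.trans hq) (by positivity)
  have hκ0 : 0 ≤ κ := by linarith
  calc _ ≤ (1 - 12 / t) * ((κ * t ^ 2 + t) * q ^ 2) := mul_le_mul_of_nonneg_left hlhs h12
    _ = (κ * t ^ 2 + t - 12 * κ * t - 12) * q ^ 2 := by
      field_simp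
      ring
    _ ≤ (κ * t ^ 2 - 4 * κ * t) * q ^ 2 := by
      refine mul_le_mul_of_nonneg_right ?_ (by positivity)
      nlinarith
    _ = κ * (s ^ 2 - 4 * (t * q ^ 2)) := by
      rw [hs]
      ring
    _ ≤ κ * (s ^ 2 - 4 * (κ * t ^ 2 + t) * s) :=
      mul_le_mul_of_nonneg_left (by linarith) hκ0
    _ ≤ _ := mul_le_mul_of_nonneg_left hrhs hκ0

theorem down_ratio {κ t q s b : ℝ} (hκ : 1 / 4 ≤ κ) (ht : 24 ≤ t)
    (hs : s = t * q) (hq : t ^ 2 ≤ q) (hb0 : 0 ≤ b) (hb : κ * t ^ 2 - t / 24 ≤ b + 1)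
    (hbs : 2 * b + 2 ≤ s) :
    (1 - 12 / t) * (κ * ((s - 2 * b) * (s - 2 * b - 1))) ≤ (b + 1) * (q ^ 2 - s + b + 1) := by
  have ht0 : 0 < t := by linarith
  have hq0 : 0 < q := lt_of_lt_of_le (by positivity) hq
  have hκ0 : 0 ≤ κ := by linarith
  have h12 : 0 ≤ 1 - 12 / t := by
    rw [sub_nonneg, div_le_one ht0]
    linarith
  have hlhs : (s - 2 * b) * (s - 2 * b - 1) ≤ s * s :=
    mul_le_mul (by linarith) (by linarith) (by linarith) (by linarith)
  have hsq : s ≤ q ^ 2 := by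
    rw [hs]
    nlinarith
  have hpos : 0 ≤ κ * t ^ 2 - t / 24 := by nlinarith
  calc _ ≤ (1 - 12 / t) * (κ * (s * s)) :=
        mul_le_mul_of_nonneg_left (mul_le_mul_of_nonneg_left hlhs hκ0) h12
    _ = κ * t ^ 2 * q ^ 2 - 12 * κ * (t * q ^ 2) := by
      rw [hs]
      field_simp
    _ ≤ κ * t ^ 2 * q ^ 2 - κ * (t * q ^ 2) - t * q ^ 2 / 24 := by
      have : 0 < t * q ^ 2 := by positivity
      nlinarith
    _ ≤ κ * t ^ 2 * q ^ 2 - κ * (t ^ 2 * (t * q)) - t * q ^ 2 / 24 + t ^ 2 * q / 24 := by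
      have h1 : t ^ 2 * (t * q) ≤ t * q ^ 2 := by
        rw [show t * q ^ 2 = q * (t * q) by ring]
        exact mul_le_mul_of_nonneg_right hq (by positivity)
      have h2 := mul_le_mul_of_nonneg_left h1 hκ0
      have h3 : 0 ≤ t ^ 2 * q / 24 := by positivity
      linarith
    _ = (κ * t ^ 2 - t / 24) * (q ^ 2 - s) := by
      rw [hs]
      ring
    _ ≤ _ := mul_le_mul hb (by linarith) (by linarith) (by linarith)

/-- A nonnegative sequence with the given consecutive ratios has no term of size much more than
`1 / t` times its sum. -/
theorem le_of_ratio {M : ℕ → ℝ} {κ t q T : ℝ} {s : ℕ} (hκ : 1 / 4 ≤ κ) (hκ' : κ ≤ 1 / 2)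
    (ht : 1 ≤ t) (hs : (s : ℝ) = t * q) (hq : t ^ 2 ≤ q) (hM : ∀ b, 0 ≤ M b)
    (hT : ∀ B : Finset ℕ, (∀ b ∈ B, 2 * b ≤ s) → ∑ b ∈ B, M b ≤ T)
    (hr : ∀ b : ℕ, 2 * b + 2 ≤ s →
      M b * (κ * ((s - 2 * b) * (s - 2 * b - 1))) = M (b + 1) * ((b + 1) * (q ^ 2 - s + b + 1)))
    {b : ℕ} (hb : 2 * b ≤ s) : t / 48 * M b ≤ T := by
  have ht0 : 0 < t := by linarith
  set n := ⌊t / 24⌋₊ with hn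
  have hn1 : (n : ℝ) ≤ t / 24 := Nat.floor_le (by positivity)
  have hn2 : t / 24 < n + 1 := Nat.lt_floor_add_one _
  obtain ⟨f, hf, hfs, hfM⟩ : ∃ f : ℕ → ℕ, Set.InjOn f (Finset.range (n + 1)) ∧
      (∀ i ∈ Finset.range (n + 1), 2 * f i ≤ s) ∧
      (∀ i ∈ Finset.range (n + 1), (1 / 2) * M b ≤ M (f i)) := by
    rcases Nat.eq_zero_or_pos n with h0 | h0
    · refine ⟨fun _ => b, ?_, fun _ _ => hb, fun _ _ => by linarith [hM b]⟩
      rw [h0]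
      simp
    have ht24 : 24 ≤ t := by
      have : (1 : ℝ) ≤ n := by exact_mod_cast h0
      linarith
    have hhalf : ∀ i ≤ n, (1 / 2) * M b ≤ (1 - 12 * i / t) * M b := by
      intro i hi
      refine mul_le_mul_of_nonneg_right ?_ (hM b)
      have : (i : ℝ) ≤ n := by exact_mod_cast hi
      have : 12 * (i : ℝ) / t ≤ 1 / 2 := by
        rw [div_le_iff₀ ht0]
        linarith
      linarith
    have hs3 : t ^ 3 ≤ s := by
      rw [hs, show t ^ 3 = t * t ^ 2 by ring]
      exact mul_le_mul_of_nonneg_left hq ht0.le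
    have hqs : (s : ℝ) ≤ q ^ 2 := by
      rw [hs]
      nlinarith
    by_cases hc : (b : ℝ) ≤ κ * t ^ 2
    · have hle : ∀ i ≤ n, ((b + i : ℕ) : ℝ) ≤ κ * t ^ 2 + t / 24 := by
        intro i hi
        have : (i : ℝ) ≤ n := by exact_mod_cast hi
        push_cast
        linarith
      have hle' : ∀ i ≤ n, 2 * (b + i) + 2 ≤ s := by
        intro i hi
        have h1 := hle i hi
        have : (2 * ((b + i : ℕ) : ℝ) + 2) ≤ s := by nlinarith
        exact_mod_cast this
      refine ⟨fun i => b + i, fun i _ j _ h => by simpa using h, fun i hi => ?_, fun i hi => ?_⟩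
      · have := hle' i (Finset.mem_range_succ_iff.1 hi)
        show 2 * (b + i) ≤ s
        omega
      · have hi := Finset.mem_range_succ_iff.1 hi
        refine (hhalf i hi).trans ?_
        refine le_of_ratio_ge (u := fun i => M (b + i)) (D := 12) ht0 (by norm_num)
          (by linarith) (n := n) (fun i hi => ?_) (hM _) i hi
        have h1 := hle i hi.le
        have h2 := hr _ (hle' i hi.le)
        have h3 := up_ratio (b := ((b + i : ℕ) : ℝ)) hκ hκ' ht24 hs hq (by positivity)
          (by linarith)
        have h4 : 0 < (((b + i : ℕ) : ℝ) + 1) * (q ^ 2 - s + ((b + i : ℕ) : ℝ) + 1) := by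
          refine mul_pos (by positivity) ?_
          have : (0 : ℝ) ≤ ((b + i : ℕ) : ℝ) := by positivity
          linarith
        refine le_of_mul_le_mul_right ?_ h4
        have h5 := mul_le_mul_of_nonneg_left h3 (hM (b + i))
        rw [h2] at h5
        show (1 - 12 / t) * M (b + i) * _ ≤ M (b + i + 1) * _
        linarith
    · push Not at hc
      have hnb : n ≤ b := by
        have : (n : ℝ) ≤ b := by nlinarith
        exact_mod_cast this
      refine ⟨fun i => b - i, fun i hi j hj h => ?_, fun i hi => ?_, fun i hi => ?_⟩
      · simp only [Finset.coe_range, Set.mem_Iio] at hi hj h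
        omega
      · show 2 * (b - i) ≤ s
        omega
      · have hi := Finset.mem_range_succ_iff.1 hi
        refine (hhalf i hi).trans ?_
        refine le_of_ratio_ge (u := fun i => M (b - i)) (D := 12) ht0 (by norm_num)
          (by linarith) (n := n) (fun i hi => ?_) (hM _) i hi
        obtain ⟨c, hcb⟩ : ∃ c, b = c + (i + 1) := ⟨b - (i + 1), by omega⟩
        have e1 : b - i = c + 1 := by omega
        have e2 : b - (i + 1) = c := by omega
        simp only [e1, e2]
        have hin : (i : ℝ) + 1 ≤ n := by exact_mod_cast hi
        have hcb' : (b : ℝ) = c + (i + 1) := by exact_mod_cast hcb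
        have hcs : 2 * c + 2 ≤ s := by omega
        have hcs' : 2 * (c : ℝ) + 2 ≤ s := by exact_mod_cast hcs
        have h2 := hr c hcs
        have h3 := down_ratio (b := (c : ℝ)) hκ ht24 hs hq (by positivity)
          (by linarith) hcs'
        have h4 : 0 < κ * (((s : ℝ) - 2 * c) * (s - 2 * c - 1)) := by
          refine mul_pos (by linarith) (mul_pos (by linarith) (by linarith))
        refine le_of_mul_le_mul_right ?_ h4
        have h5 := mul_le_mul_of_nonneg_left h3 (hM (c + 1))
        rw [← h2] at h5
        linarith
  have h1 := hT ((Finset.range (n + 1)).image f) (by simpa using fun i hi => hfs i (by simpa using hi))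
  rw [Finset.sum_image hf] at h1
  have h2 := Finset.card_nsmul_le_sum _ _ _ hfM
  rw [Finset.card_range, nsmul_eq_mul] at h2
  push_cast at h2
  have h3 := mul_le_mul_of_nonneg_right hn2.le (hM b)
  linarith

/-- Lowering the lower index of a binomial coefficient by three. -/
theorem choose_sub_three_mul_le {N m s : ℕ} (hs : 3 ≤ s) (hN : m + s ≤ N) :
    N.choose (s - 3) * m ^ 3 ≤ N.choose s * s ^ 3 := by
  have step : ∀ k, k + 1 ≤ s → N.choose k * m ≤ N.choose (k + 1) * s := by
    intro k hk
    calc N.choose k * m ≤ N.choose k * (N - k) := Nat.mul_le_mul_left _ (by omega)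
      _ = N.choose (k + 1) * (k + 1) := (Nat.choose_succ_right_eq N k).symm
      _ ≤ _ := Nat.mul_le_mul_left _ hk
  obtain ⟨k, rfl⟩ : ∃ k, s = k + 3 := ⟨s - 3, by omega⟩
  calc N.choose k * m ^ 3 = N.choose k * m * m ^ 2 := by ring
    _ ≤ N.choose (k + 1) * (k + 3) * m ^ 2 := Nat.mul_le_mul_right _ (step k (by omega))
    _ = N.choose (k + 1) * m * ((k + 3) * m) := by ring
    _ ≤ N.choose (k + 2) * (k + 3) * ((k + 3) * m) :=
      Nat.mul_le_mul_right _ (step (k + 1) (by omega))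
    _ = N.choose (k + 2) * m * (k + 3) ^ 2 := by ring
    _ ≤ N.choose (k + 3) * (k + 3) * (k + 3) ^ 2 :=
      Nat.mul_le_mul_right _ (step (k + 2) (by omega))
    _ = _ := by ring

end Analysis

/-- For fixed `r ≥ 2` there is a constant `c₀` such that for `μ^{5/9} < s < μ^{3/5}`,
the number of parts hit by a uniformly random `s`-subset takes any particular value
with probability at most `c₀ μ^{1/2}/s`. -/
theorem parts_hit_anticoncentration (r : ℕ) (hr : 2 ≤ r) :
    ∃ c₀ : ℝ, 0 < c₀ ∧ ∀ μ s : ℕ,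
      (μ : ℝ) ^ ((5 : ℝ) / 9) < (s : ℝ) → (s : ℝ) < (μ : ℝ) ^ ((3 : ℝ) / 5) →
      ∀ j : ℕ, subsetProb r μ s (fun S => numPartsHit S = j)
        ≤ c₀ * (μ : ℝ) ^ ((1 : ℝ) / 2) / (s : ℝ) := by
  refine ⟨48 + r ^ 3, by positivity, fun μ s h1 h2 j => ?_⟩
  have hμ : 1 ≤ μ := by
    rcases Nat.eq_zero_or_pos μ with h | h
    · subst h
      rw [Nat.cast_zero, Real.zero_rpow (by norm_num)] at h1 h2
      linarith
    · exact h
  have hμ1 : (1 : ℝ) ≤ μ := by exact_mod_cast hμ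
  have hμ0 : (0 : ℝ) < μ := by linarith
  have hs0 : (0 : ℝ) < s := (Real.rpow_nonneg hμ0.le _).trans_lt h1
  set q : ℝ := (μ : ℝ) ^ ((1 : ℝ) / 2) with hqdef
  have hq0 : 0 < q := Real.rpow_pos_of_pos hμ0 _
  have hq2 : q ^ 2 = μ := by
    rw [hqdef, ← Real.rpow_natCast, ← Real.rpow_mul hμ0.le]
    norm_num
  have hqs : q ≤ s :=
    (Real.rpow_le_rpow_of_exponent_le hμ1 (by norm_num)).trans h1.le
  have hsμ : s < μ := by
    have : (s : ℝ) < μ := h2.trans_le (by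
      conv_rhs => rw [← Real.rpow_one (μ : ℝ)]
      exact Real.rpow_le_rpow_of_exponent_le hμ1 (by norm_num))
    exact_mod_cast this
  have hs2 : (s : ℝ) ^ 2 ≤ q ^ 3 := by
    have e1 : (s : ℝ) ^ 2 ≤ ((μ : ℝ) ^ ((3 : ℝ) / 5)) ^ 2 :=
      pow_le_pow_left₀ hs0.le h2.le 2
    refine e1.trans ?_
    rw [hqdef, ← Real.rpow_natCast, ← Real.rpow_natCast, ← Real.rpow_mul hμ0.le,
      ← Real.rpow_mul hμ0.le]
    exact Real.rpow_le_rpow_of_exponent_le hμ1 (by norm_num)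
  have hs4 : (s : ℝ) ^ 4 ≤ q ^ 5 := by
    have e1 : (s : ℝ) ^ 4 ≤ ((μ : ℝ) ^ ((3 : ℝ) / 5)) ^ 4 :=
      pow_le_pow_left₀ hs0.le h2.le 4
    refine e1.trans ?_
    rw [hqdef, ← Real.rpow_natCast, ← Real.rpow_natCast, ← Real.rpow_mul hμ0.le,
      ← Real.rpow_mul hμ0.le]
    exact Real.rpow_le_rpow_of_exponent_le hμ1 (by norm_num)
  have hr2 : (2 : ℝ) ≤ r := by exact_mod_cast hr
  have hr0 : (0 : ℝ) < r := by linarith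
  have hN : μ + s ≤ r * μ := by nlinarith
  have hCpos : 0 < (sSubsets r μ s).card := by
    rw [card_sSubsets]
    exact Nat.choose_pos (by omega)
  have hC0 : (0 : ℝ) < (sSubsets r μ s).card := by exact_mod_cast hCpos
  have htriple : (((sSubsets r μ s).filter (fun S => ∃ i, 3 ≤ fiberCard S i)).card : ℝ)
      ≤ r ^ 3 * (q / s) * (sSubsets r μ s).card := by
    rcases lt_or_ge s 3 with hs3 | hs3
    · rw [Finset.filter_false_of_mem, Finset.card_empty, Nat.cast_zero]
      · positivity
      · rintro S hS ⟨i, hi⟩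
        have e1 : fiberCard S i ≤ S.card := Finset.card_filter_le _ _
        have e2 := (Finset.mem_powersetCard.1 hS).2
        omega
    have a1 : (((sSubsets r μ s).filter (fun S => ∃ i, 3 ≤ fiberCard S i)).card : ℝ)
      ≤ μ * r ^ 3 * (r * μ).choose (s - 3) := by exact_mod_cast card_three_le_fiberCard r μ s
    have a2 : ((r * μ).choose (s - 3) : ℝ) * μ ^ 3 ≤ (sSubsets r μ s).card * s ^ 3 := by
      rw [card_sSubsets]
      exact_mod_cast choose_sub_three_mul_le hs3 hN
    have a3 : ((r * μ).choose (s - 3) : ℝ) ≤ (sSubsets r μ s).card * s ^ 3 / μ ^ 3 := by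
      rwa [le_div_iff₀ (by positivity)]
    refine a1.trans ?_
    calc _ ≤ μ * (r : ℝ) ^ 3 * ((sSubsets r μ s).card * s ^ 3 / μ ^ 3) := by gcongr
      _ = (r : ℝ) ^ 3 * ((s : ℝ) ^ 4 / q ^ 4 / s) * (sSubsets r μ s).card := by
        rw [← hq2]
        field_simp
      _ ≤ (r : ℝ) ^ 3 * (q / s) * (sSubsets r μ s).card := by
        gcongr
        rw [div_le_iff₀ (by positivity)]
        linarith [show q * q ^ 4 = q ^ 5 by ring]
  have hmain : ∀ b : ℕ, 2 * b ≤ s →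
      ((singleDouble r μ (s - 2 * b) b).card : ℝ) ≤ 48 * (q / s) * (sSubsets r μ s).card := by
    intro b hb
    have := le_of_ratio (M := fun b => ((singleDouble r μ (s - 2 * b) b).card : ℝ))
      (κ := (r - 1) / (2 * r)) (t := s / q) (q := q) (T := (sSubsets r μ s).card) (s := s)
      (by rw [div_le_div_iff₀ (by norm_num) (by positivity)]; linarith)
      (by rw [div_le_div_iff₀ (by positivity) (by norm_num)]; linarith)
      (by rwa [one_le_div hq0]) (by field_simp)
      (by rw [div_pow, div_le_iff₀ (by positivity)]; linarith [show q * q ^ 2 = q ^ 3 by ring])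
      (fun b => by positivity)
      (fun B hB => by exact_mod_cast sum_singleDouble_le r μ s B hB)
      (fun b hb => by
        obtain ⟨a, ha⟩ : ∃ a, s = a + 2 * b + 2 := ⟨s - 2 * b - 2, by omega⟩
        have h := singleDouble_ratio r μ a b
        obtain ⟨d, hd⟩ : ∃ d, μ = d + (a + 1 + b) := ⟨μ - (a + 1 + b), by omega⟩
        obtain ⟨r', hr'⟩ : ∃ r', r = r' + 1 := ⟨r - 1, by omega⟩
        rw [show s - 2 * b = a + 2 by omega, show s - 2 * (b + 1) = a by omega]
        rw [show μ - (a + 1 + b) = d by omega, show r - 1 = r' by omega] at h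
        have h' : ((singleDouble r μ (a + 2) b).card : ℝ) * ((a + 2) * (a + 1) * r')
          = (singleDouble r μ a (b + 1)).card * (2 * (b + 1) * r * d) := by exact_mod_cast h
        have e1 : (s : ℝ) = a + 2 * b + 2 := by exact_mod_cast ha
        have e2 : q ^ 2 = d + (a + 1 + b) := by rw [hq2]; exact_mod_cast hd
        have e3 : (r : ℝ) - 1 = r' := by rw [hr']; push_cast; ring
        rw [e1, e2, e3]
        field_simp
        linear_combination h')
      hb
    calc _ = 48 * (q / s) * (s / q / 48 * ((singleDouble r μ (s - 2 * b) b).card : ℝ)) := by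
          field_simp
      _ ≤ _ := by gcongr
  rw [subsetProb, div_le_iff₀ hC0]
  have hle := (Finset.card_le_card (filter_numPartsHit_subset r μ s j)).trans
    (Finset.card_union_le _ _)
  have hle' : (((sSubsets r μ s).filter (fun S => numPartsHit S = j)).card : ℝ) ≤
      ((sSubsets r μ s).filter (fun S => ∃ i, 3 ≤ fiberCard S i)).card +
      (if j ≤ s ∧ 2 * (s - j) ≤ s then singleDouble r μ (s - 2 * (s - j)) (s - j) else ∅).card := by
    exact_mod_cast hle
  have hif : ((if j ≤ s ∧ 2 * (s - j) ≤ s then singleDouble r μ (s - 2 * (s - j)) (s - j)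
      else ∅).card : ℝ) ≤ 48 * (q / s) * (sSubsets r μ s).card := by
    split_ifs with h
    · exact hmain _ h.2
    · rw [Finset.card_empty, Nat.cast_zero]
      positivity
  calc _ ≤ r ^ 3 * (q / s) * (sSubsets r μ s).card + 48 * (q / s) * (sSubsets r μ s).card :=
        hle'.trans (add_le_add htriple hif)
    _ = _ := by ring
end

section
/- Let r ≥ 2 and let R be a set of size rμ partitioned into μ parts R_1,...,R_μ each of size r, with S a uniformly random s-element subset of R. For every integer j with s/2 ≤ j < s and j + 1 ≤ μ, the quantities P_j satisfy the exact ratio identity P_{j+1}·(r-1)·(2j+2-s)·(2j+1-s) = P_j·2r·(μ-j)·(s-j); equivalently, when P_j > 0, P_{j+1}/P_j = [(μ-j)(s-j) / ((2j+2-s)(2j+1-s))] · 2r/(r-1). -/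
/-- The number of elements of `S` in the part `R_i`. -/
def partCount {μ r : ℕ} (S : Finset (Fin μ × Fin r)) (i : Fin μ) : ℕ :=
  (S.filter (fun x => x.1 = i)).card

/-- The `s`-element subsets hitting exactly `j` parts, each in at most two elements. -/
def sparseSubsets (r μ s j : ℕ) : Finset (Finset (Fin μ × Fin r)) :=
  (sSubsets r μ s).filter (fun S => numPartsHit S = j ∧
    ∀ i : Fin μ, (S.filter (fun x => x.1 = i)).card ≤ 2)

section PartCount

open Finset

variable {μ r : ℕ}

theorem numPartsHit_eq_card (S : Finset (Fin μ × Fin r)) :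
    numPartsHit S = #{i | partCount S i ≠ 0} := by
  unfold numPartsHit partCount
  congr 1
  ext i
  simp [Finset.filter_eq_empty_iff]

theorem mem_sparseSubsets {s j : ℕ} {S : Finset (Fin μ × Fin r)} :
    S ∈ sparseSubsets r μ s j ↔
      #S = s ∧ #{i | partCount S i ≠ 0} = j ∧ ∀ i, partCount S i ≤ 2 := by
  simp [sparseSubsets, sSubsets, numPartsHit_eq_card, partCount]

theorem card_eq_sum_partCount (S : Finset (Fin μ × Fin r)) : #S = ∑ i, partCount S i :=
  card_eq_sum_card_fiberwise fun _ _ => mem_coe.2 (mem_univ _)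

theorem card_filter_fst {S : Finset (Fin μ × Fin r)} {p : Fin μ → Prop} [DecidablePred p] {k : ℕ}
    (h : ∀ i, p i → partCount S i = k) : #{x ∈ S | p x.1} = #{i | p i} * k := by
  rw [card_eq_sum_card_fiberwise (f := Prod.fst) (t := ({i | p i} : Finset (Fin μ)))
    (by intro x hx; simpa using (mem_filter.1 hx).2)]
  refine sum_const_nat fun i hi => ?_
  have hi : p i := by simpa using hi
  rw [← h i hi, partCount, filter_filter]
  congr 1
  ext x
  simp only [mem_filter]
  constructor
  · rintro ⟨hx, _, h⟩
    exact ⟨hx, h⟩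
  · rintro ⟨hx, rfl⟩
    exact ⟨hx, hi, rfl⟩

theorem partCount_univ (i : Fin μ) : partCount (univ : Finset (Fin μ × Fin r)) i = r := by
  have : ({x | x.1 = i} : Finset (Fin μ × Fin r)) = {i} ×ˢ univ := by
    ext x
    simp [Prod.ext_iff, eq_comm]
  rw [partCount, this]
  simp

theorem partCount_compl (S : Finset (Fin μ × Fin r)) (i : Fin μ) :
    partCount Sᶜ i = r - partCount S i := by
  have h := card_union_of_disjoint (disjoint_compl_right.mono (filter_subset (·.1 = i) S)
    (filter_subset (·.1 = i) Sᶜ))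
  rw [← filter_union, union_compl] at h
  have hu := partCount_univ (r := r) i
  unfold partCount at *
  omega

theorem partCount_pos {S : Finset (Fin μ × Fin r)} {x : Fin μ × Fin r} (hx : x ∈ S) :
    0 < partCount S x.1 :=
  card_pos.2 ⟨x, mem_filter.2 ⟨hx, rfl⟩⟩

theorem partCount_swap {S : Finset (Fin μ × Fin r)} {x y : Fin μ × Fin r} (hx : x ∈ S)
    (hy : y ∉ S) (i : Fin μ) :
    partCount (insert y (S.erase x)) i + (if x.1 = i then 1 else 0) =
      partCount S i + (if y.1 = i then 1 else 0) := by
  have hy' : y ∉ S.erase x := fun h => hy (mem_of_mem_erase h)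
  have h₁ : partCount (insert y (S.erase x)) i =
      partCount (S.erase x) i + (if y.1 = i then 1 else 0) := by
    unfold partCount
    rw [filter_insert]
    split_ifs
    · exact card_insert_of_notMem fun h => hy' (mem_filter.1 h).1
    · rfl
  have h₂ : partCount S i = partCount (S.erase x) i + (if x.1 = i then 1 else 0) := by
    conv_lhs => rw [← insert_erase hx]
    unfold partCount
    rw [filter_insert]
    split_ifs
    · exact card_insert_of_notMem fun h => notMem_erase x S (mem_filter.1 h).1
    · rfl
  omega

theorem card_swap {S : Finset (Fin μ × Fin r)} {x y : Fin μ × Fin r} (hx : x ∈ S)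
    (hy : y ∉ S) : #(insert y (S.erase x)) = #S := by
  rw [card_insert_of_notMem fun h => hy (mem_of_mem_erase h), card_erase_add_one hx]

theorem card_parts_of_mem {s j : ℕ} {S : Finset (Fin μ × Fin r)}
    (hS : S ∈ sparseSubsets r μ s j) :
    #{i | partCount S i = 0} + j = μ ∧ #{i | partCount S i = 1} + s = 2 * j ∧
      #{i | partCount S i = 2} + j = s := by
  obtain ⟨hs, hj, h2⟩ := mem_sparseSubsets.1 hS
  have h₀ : #{i | partCount S i = 0} + #{i | partCount S i ≠ 0} = μ := by
    rw [card_filter_add_card_filter_not, card_univ, Fintype.card_fin]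
  have h₁ : #{i | partCount S i ≠ 0} =
      #{i | partCount S i = 1} + #{i | partCount S i = 2} := by
    simp only [card_filter, ← sum_add_distrib]
    refine sum_congr rfl fun i _ => ?_
    have := h2 i
    split_ifs <;> omega
  have h₂ : #S = #{i | partCount S i = 1} + 2 * #{i | partCount S i = 2} := by
    rw [card_eq_sum_partCount]
    simp only [card_filter, mul_sum, ← sum_add_distrib]
    refine sum_congr rfl fun i _ => ?_
    have := h2 i
    split_ifs <;> omega
  omega

/-- The pairs `(x, y)` for which exchanging `x` for `y` splits a two-element part of `S`
into two singleton parts. -/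
def splitPairs (S : Finset (Fin μ × Fin r)) : Finset ((Fin μ × Fin r) × (Fin μ × Fin r)) :=
  {x ∈ S | partCount S x.1 = 2} ×ˢ ({y | partCount S y.1 = 0} : Finset (Fin μ × Fin r))

/-- The pairs `(y, x)` for which exchanging `y` for `x` merges two singleton parts of `T`
into a two-element part. -/
def mergePairs (T : Finset (Fin μ × Fin r)) : Finset (Σ _ : Fin μ × Fin r, Fin μ × Fin r) :=
  {y ∈ T | partCount T y.1 = 1}.sigma fun y => {x ∈ Tᶜ | partCount T x.1 = 1 ∧ x.1 ≠ y.1}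

theorem card_splitPairs {s j : ℕ} {S : Finset (Fin μ × Fin r)}
    (hS : S ∈ sparseSubsets r μ s j) :
    #(splitPairs S) = (s - j) * 2 * ((μ - j) * r) := by
  have h := card_parts_of_mem hS
  rw [splitPairs, card_product, card_filter_fst (p := fun i => partCount S i = 2) fun _ h => h,
    card_filter_fst (p := fun i => partCount S i = 0) fun i _ => partCount_univ i]
  congr 2 <;> omega

theorem card_mergePairs {s j : ℕ} {T : Finset (Fin μ × Fin r)}
    (hT : T ∈ sparseSubsets r μ s j) :
    #(mergePairs T) = (2 * j - s) * ((2 * j - s - 1) * (r - 1)) := by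
  have h := card_parts_of_mem hT
  rw [mergePairs, card_sigma, sum_const_nat (m := (2 * j - s - 1) * (r - 1)),
    card_filter_fst (p := fun i => partCount T i = 1) fun _ h => h, mul_one]
  · congr 1
    omega
  · intro y hy
    have hy1 : partCount T y.1 = 1 := (mem_filter.1 hy).2
    rw [card_filter_fst (p := fun i => partCount T i = 1 ∧ i ≠ y.1) (k := r - 1)
      fun i hi => by rw [partCount_compl, hi.1]]
    have : ({i | partCount T i = 1 ∧ i ≠ y.1} : Finset (Fin μ)) =
        ({i | partCount T i = 1} : Finset (Fin μ)).erase y.1 := by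
      ext i
      simp [and_comm]
    rw [this, card_erase_of_mem (by simpa using hy1)]
    congr 2
    omega

theorem swap_swap {S : Finset (Fin μ × Fin r)} {x y : Fin μ × Fin r} (hx : x ∈ S)
    (hy : y ∉ S) : insert x ((insert y (S.erase x)).erase y) = S := by
  rw [erase_insert fun h => hy (mem_of_mem_erase h), insert_erase hx]

theorem split_mem {s j : ℕ} {S : Finset (Fin μ × Fin r)} {x y : Fin μ × Fin r}
    (hS : S ∈ sparseSubsets r μ s j) (h : (x, y) ∈ splitPairs S) :
    insert y (S.erase x) ∈ sparseSubsets r μ s (j + 1) ∧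
      ⟨y, x⟩ ∈ mergePairs (insert y (S.erase x)) ∧ x ∈ S ∧ y ∉ S := by
  obtain ⟨hs, hj, h2⟩ := mem_sparseSubsets.1 hS
  simp only [splitPairs, mem_product, mem_filter, mem_univ, true_and] at h
  obtain ⟨⟨hx, hx2⟩, hy0⟩ := h
  have hy : y ∉ S := fun h => (partCount_pos h).ne' hy0
  have hxy : x.1 ≠ y.1 := fun h => by rw [h] at hx2; omega
  have hc := partCount_swap hx hy
  have hcx := hc x.1
  have hcy := hc y.1
  simp only [if_true, if_neg hxy, if_neg hxy.symm] at hcx hcy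
  refine ⟨mem_sparseSubsets.2 ⟨(card_swap hx hy).trans hs, ?_, fun i => ?_⟩, ?_, hx, hy⟩
  · have : ({i | partCount (insert y (S.erase x)) i ≠ 0} : Finset (Fin μ)) =
        insert y.1 ({i | partCount S i ≠ 0} : Finset (Fin μ)) := by
      ext i
      have := hc i
      simp only [mem_filter, mem_univ, true_and, mem_insert]
      grind
    rw [this, card_insert_of_notMem (by simp [hy0]), hj]
  · have := hc i
    have := h2 i
    grind
  · simp only [mergePairs, mem_sigma, mem_filter, mem_compl]
    grind

theorem merge_mem {s j : ℕ} {T : Finset (Fin μ × Fin r)} {x y : Fin μ × Fin r}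
    (hT : T ∈ sparseSubsets r μ s (j + 1)) (h : ⟨y, x⟩ ∈ mergePairs T) :
    insert x (T.erase y) ∈ sparseSubsets r μ s j ∧
      (x, y) ∈ splitPairs (insert x (T.erase y)) ∧ y ∈ T ∧ x ∉ T := by
  obtain ⟨hs, hj, h2⟩ := mem_sparseSubsets.1 hT
  simp only [mergePairs, mem_sigma, mem_filter, mem_compl] at h
  obtain ⟨⟨hy, hy1⟩, hx, hx1, hxy⟩ := h
  have hc := partCount_swap hy hx
  have hcx := hc x.1
  have hcy := hc y.1
  simp only [if_true, if_neg hxy, if_neg hxy.symm] at hcx hcy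
  refine ⟨mem_sparseSubsets.2 ⟨(card_swap hy hx).trans hs, ?_, fun i => ?_⟩, ?_, hy, hx⟩
  · have : ({i | partCount (insert x (T.erase y)) i ≠ 0} : Finset (Fin μ)) =
        ({i | partCount T i ≠ 0} : Finset (Fin μ)).erase y.1 := by
      ext i
      have := hc i
      simp only [mem_filter, mem_univ, true_and, mem_erase]
      grind
    rw [this, card_erase_of_mem (by simp [hy1]), hj, Nat.add_sub_cancel]
  · have := hc i
    have := h2 i
    grind
  · simp only [splitPairs, mem_product, mem_filter, mem_univ, true_and, mem_insert]
    grind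

theorem sum_card_splitPairs (s j : ℕ) :
    ∑ S ∈ sparseSubsets r μ s j, #(splitPairs S) =
      ∑ T ∈ sparseSubsets r μ s (j + 1), #(mergePairs T) := by
  rw [← card_sigma, ← card_sigma]
  refine card_bij' (fun p _ => ⟨insert p.2.2 (p.1.erase p.2.1), ⟨p.2.2, p.2.1⟩⟩)
    (fun p _ => ⟨insert p.2.2 (p.1.erase p.2.1), (p.2.2, p.2.1)⟩) ?_ ?_ ?_ ?_
  · rintro ⟨S, x, y⟩ h
    obtain ⟨hS, h⟩ := mem_sigma.1 h
    have := split_mem hS h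
    exact mem_sigma.2 ⟨this.1, this.2.1⟩
  · rintro ⟨T, y, x⟩ h
    obtain ⟨hT, h⟩ := mem_sigma.1 h
    have := merge_mem hT h
    exact mem_sigma.2 ⟨this.1, this.2.1⟩
  · rintro ⟨S, x, y⟩ h
    obtain ⟨hS, h⟩ := mem_sigma.1 h
    obtain ⟨-, -, hx, hy⟩ := split_mem hS h
    simp only [swap_swap hx hy]
  · rintro ⟨T, y, x⟩ h
    obtain ⟨hT, h⟩ := mem_sigma.1 h
    obtain ⟨-, -, hy, hx⟩ := merge_mem hT h
    simp only [swap_swap hy hx]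

theorem card_sparseSubsets_succ (r μ s j : ℕ) :
    #(sparseSubsets r μ s j) * ((s - j) * 2 * ((μ - j) * r)) =
      #(sparseSubsets r μ s (j + 1)) *
        ((2 * (j + 1) - s) * ((2 * (j + 1) - s - 1) * (r - 1))) := by
  rw [← sum_const_nat fun S hS => card_splitPairs hS,
    ← sum_const_nat fun T hT => card_mergePairs hT]
  exact sum_card_splitPairs s j

end PartCount

/-- Ratio identity for consecutive `P_j`: for `s/2 ≤ j < s` with `j + 1 ≤ μ`,
`P_{j+1}·(r-1)·(2j+2-s)·(2j+1-s) = P_j·2r·(μ-j)·(s-j)`; equivalently, when `P_j > 0`,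
`P_{j+1}/P_j = ((μ-j)(s-j)/((2j+2-s)(2j+1-s)))·(2r/(r-1))`. -/
theorem Pj_ratio (r μ s : ℕ) (hr : 2 ≤ r) :
    ∀ j : ℕ, (s : ℝ) / 2 ≤ (j : ℝ) → j < s → j + 1 ≤ μ →
      (Pj r μ s (j + 1) * ((r : ℝ) - 1) * (2 * (j : ℝ) + 2 - (s : ℝ)) *
          (2 * (j : ℝ) + 1 - (s : ℝ))
        = Pj r μ s j * (2 * (r : ℝ)) * ((μ : ℝ) - (j : ℝ)) * ((s : ℝ) - (j : ℝ))) ∧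
      (0 < Pj r μ s j →
        Pj r μ s (j + 1) / Pj r μ s j
          = ((μ : ℝ) - (j : ℝ)) * ((s : ℝ) - (j : ℝ)) /
              ((2 * (j : ℝ) + 2 - (s : ℝ)) * (2 * (j : ℝ) + 1 - (s : ℝ))) *
            (2 * (r : ℝ) / ((r : ℝ) - 1))) := by
  intro j hsj hjs hjμ
  have hsj' : s ≤ 2 * j := by
    have : (s : ℝ) ≤ ((2 * j : ℕ) : ℝ) := by
      push_cast
      linarith
    exact_mod_cast this
  have key : Pj r μ s (j + 1) * ((r : ℝ) - 1) * (2 * (j : ℝ) + 2 - (s : ℝ)) *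
      (2 * (j : ℝ) + 1 - (s : ℝ)) =
      Pj r μ s j * (2 * (r : ℝ)) * ((μ : ℝ) - (j : ℝ)) * ((s : ℝ) - (j : ℝ)) := by
    have h := congrArg (Nat.cast : ℕ → ℝ) (card_sparseSubsets_succ r μ s j)
    rw [Nat.sub_sub] at h
    push_cast [Nat.cast_sub hjs.le, Nat.cast_sub (show j ≤ μ by omega),
      Nat.cast_sub (show s ≤ 2 * (j + 1) by omega),
      Nat.cast_sub (show s + 1 ≤ 2 * (j + 1) by omega),
      Nat.cast_sub (show 1 ≤ r by omega)] at h
    have hP : ∀ k, Pj r μ s k =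
        ((sparseSubsets r μ s k).card : ℝ) / ((sSubsets r μ s).card : ℝ) := fun _ => rfl
    rw [hP, hP]
    linear_combination (-((sSubsets r μ s).card : ℝ)⁻¹) * h
  refine ⟨key, fun hpos => ?_⟩
  have hr' : (2 : ℝ) ≤ r := by exact_mod_cast hr
  have h₀ : (r : ℝ) - 1 ≠ 0 := by linarith
  have h₁ : 2 * (j : ℝ) + 2 - s ≠ 0 := by linarith
  have h₂ : 2 * (j : ℝ) + 1 - s ≠ 0 := by linarith
  rw [div_mul_div_comm, div_eq_div_iff hpos.ne' (mul_ne_zero (mul_ne_zero h₁ h₂) h₀)]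
  linear_combination key
end
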